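/- Theorem of Lonjou: for every field k, the plane Cremona group Bir(ℙ²_k) = Aut_k(k(x,y)) is not a simple group; it possesses a normal subgroup different from the trivial subgroup and from the whole group. -/

import Mathlib

set_option autoImplicit false

noncomputable section

universe u

/-- The plane Cremona group `Bir(ℙ²_k) = Aut_k(k(x,y))` over a field `k`. -/
abbrev CremonaK (k : Type u) [Field k] : Type u :=
  FractionRing (MvPolynomial (Fin 2) k) ≃ₐ[k] FractionRing (MvPolynomial (Fin 2) k)

theorem natAbs_sub_triangle (a b c : ℤ) :
    (a - c).natAbs ≤ (a - b).natAbs + (b - c).natAbs := by omega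

theorem natAbs_sub_symm (a b : ℤ) : (a - b).natAbs = (b - a).natAbs := by omega

theorem far_from_ends (θ : ℕ) (hθ : 1 ≤ θ) (qa qj qj' qb p q : ℤ)
    (hT : 100 * θ ≤ (qj - qj').natAbs) (hl : (qa - qj).natAbs ≤ 6 * θ)
    (hr : (qj' - qb).natAbs ≤ 6 * θ) (hpq : (p - q).natAbs < 6 * θ)
    (hQ : (qb - q).natAbs ≤ (qj - q).natAbs + θ) : 25 * θ ≤ (qa - p).natAbs := by
  have h1 := natAbs_sub_triangle qj qa q
  have h2 := natAbs_sub_triangle qa p q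
  have h3 := natAbs_sub_triangle qj q qj'
  have h4 := natAbs_sub_triangle q qb qj'
  have h5 := natAbs_sub_symm qj qa
  have h6 := natAbs_sub_symm q qb
  have h7 := natAbs_sub_symm qb qj'
  generalize (qj - qj').natAbs = A at *
  lia

set_option maxHeartbeats 1000000 in
theorem proj_bounded {X : Type*} (pos : X → X → ℤ) (ρ : X → X → ℕ) (ne : X → X → Prop)
    (θ : ℕ) (hθ : 1 ≤ θ) (hne : ∀ a b, ne a b → ne b a)
    (A2 : ∀ f f' w, ne f f' → θ < (pos f' f - pos f' w).natAbs →
      (pos f f' - pos f w).natAbs ≤ θ)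
    (A3 : ∀ f f' q, ne f f' → ρ f' q ≤ ρ f q → (pos f q - pos f f').natAbs ≤ θ)
    (A4 : ∀ f f' q q', ne f f' → ρ f' q ≤ ρ f' q' → ρ f q' ≤ ρ f q →
      (pos f q - pos f f').natAbs ≤ (pos f q' - pos f f').natAbs + θ)
    (n : ℕ) (q z : ℕ → X)
    (hV : ∀ i < n, ∀ l ≤ n, ρ (z i) (q i) ≤ ρ (z i) (q l))
    (hV' : ∀ i < n, ρ (z i) (q (i + 1)) = ρ (z i) (q i))
    (hT : ∀ i < n, 100 * θ ≤ (pos (z i) (q i) - pos (z i) (q (i + 1))).natAbs)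
    (hD : ∀ i < n, ∀ j < n, i ≠ j → ne (z i) (z j)) :
    ∀ m a b : ℕ, b = a + m → b ≤ n → ∀ Y P Q U V : X,
      (∀ i, a ≤ i → i < b → ne Y (z i)) →
      (∀ i l, a ≤ i → i < b → a ≤ l → l ≤ b → ρ (z i) (q i) ≤ ρ Y (q l)) →
      ((P = q a ∧ U = q a) ∨ (∃ a', a = a' + 1 ∧ P = z a' ∧ ne Y P ∧ ρ P (q a) ≤ ρ Y (q a) ∧
        (pos P Q - pos P V).natAbs ≤ θ ∧ 4 * θ ≤ (pos P U - pos P V).natAbs ∧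
        (pos Y U - pos Y P).natAbs ≤ θ)) →
      ((Q = q b ∧ V = q b) ∨ (b < n ∧ Q = z b ∧ ne Y Q ∧ ρ Q (q b) ≤ ρ Y (q b) ∧
        (pos Q P - pos Q U).natAbs ≤ θ ∧ 4 * θ ≤ (pos Q U - pos Q V).natAbs ∧
        (pos Y V - pos Y Q).natAbs ≤ θ)) →
      (pos Y U - pos Y V).natAbs ≤ 6 * θ := by
  intro m
  induction m using Nat.strong_induction_on with
  | _ m ih =>
  intro a b hab hbn Y P Q U V hY hρ hL hR
  rcases Nat.eq_zero_or_pos m with hm | hm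
  · -- empty interval
    obtain rfl : b = a := by omega
    have h1 : (pos Y (q b) - pos Y P).natAbs ≤ θ ∧ (pos Y U - pos Y P).natAbs ≤ θ := by
      rcases hL with ⟨h, h'⟩ | ⟨a', -, -, h1, h2, -, -, h3⟩
      · subst h h'; constructor <;> omega
      · exact ⟨A3 _ _ _ h1 h2, h3⟩
    have h2 : (pos Y (q b) - pos Y Q).natAbs ≤ θ ∧ (pos Y V - pos Y Q).natAbs ≤ θ := by
      rcases hR with ⟨h, h'⟩ | ⟨-, -, h1, h2, -, -, h3⟩
      · subst h h'; constructor <;> omega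
      · exact ⟨A3 _ _ _ h1 h2, h3⟩
    omega
  obtain ⟨j, hj, hjmax⟩ := Finset.exists_max_image (Finset.Ico a b) (fun i => ρ (z i) (q i))
    ⟨a, by simp; omega⟩
  rw [Finset.mem_Ico] at hj
  obtain ⟨haj, hjb⟩ := hj
  have hjmax' : ∀ i, a ≤ i → i < b → ρ (z i) (q i) ≤ ρ (z j) (q j) := fun i h1 h2 =>
    hjmax i (Finset.mem_Ico.2 ⟨h1, h2⟩)
  have hjn : j < n := by omega
  have hYX : ne Y (z j) := hY j haj hjb
  have hXY := hne _ _ hYX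
  -- the two halves have bounded projection to the top axis
  have hl : (pos (z j) (q a) - pos (z j) (q j)).natAbs ≤ 6 * θ := by
    refine ih (j - a) (by omega) a j (by omega) (by omega) (z j) (q a) (q j) (q a) (q j) ?_ ?_
      (Or.inl ⟨rfl, rfl⟩) (Or.inl ⟨rfl, rfl⟩)
    · intro i h1 h2; exact hD _ hjn _ (by omega) (by omega)
    · intro i l h1 h2 h3 h4
      exact (hjmax' i h1 (by omega)).trans (hV j hjn l (by omega))
  have hr : (pos (z j) (q (j + 1)) - pos (z j) (q b)).natAbs ≤ 6 * θ := by
    refine ih (b - (j + 1)) (by omega) (j + 1) b (by omega) (by omega) (z j) (q (j + 1)) (q b)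
      (q (j + 1)) (q b) ?_ ?_ (Or.inl ⟨rfl, rfl⟩) (Or.inl ⟨rfl, rfl⟩)
    · intro i h1 h2; exact hD _ hjn _ (by omega) (by omega)
    · intro i l h1 h2 h3 h4
      exact (hjmax' i (by omega) (by omega)).trans (hV j hjn l (by omega))
  have hTj := hT j hjn
  have hPX : P = q a ∨ ne P (z j) := by
    rcases hL with ⟨h, h'⟩ | ⟨a', h0, h, -⟩
    · exact Or.inl h
    · right; rw [h]; exact hD _ (by omega) _ hjn (by omega)
  have hQX : Q = q b ∨ ne Q (z j) := by
    rcases hR with ⟨h, h'⟩ | ⟨h0, h, -⟩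
    · exact Or.inl h
    · right; rw [h]; exact hD _ (by omega) _ hjn (by omega)
  by_cases hbig : 6 * θ ≤ (pos (z j) P - pos (z j) Q).natAbs
  · have hUP : (pos (z j) P - pos (z j) U).natAbs ≤ θ := by
      rcases hL with ⟨h, h'⟩ | ⟨a', h0, h, h1, h2, h3, h4, h5⟩
      · subst h h'; omega
      · have hPX' : ne P (z j) := by rw [h]; exact hD _ (by omega) _ hjn (by omega)
        have e1 := A2 P (z j) Q hPX' (by omega)
        exact A2 (z j) P U (hne _ _ hPX') (by omega)
    have hVQ : (pos (z j) Q - pos (z j) V).natAbs ≤ θ := by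
      rcases hR with ⟨h, h'⟩ | ⟨h0, h, h1, h2, h3, h4, h5⟩
      · subst h h'; omega
      · have hQX' : ne Q (z j) := by rw [h]; exact hD _ (by omega) _ hjn (by omega)
        have e1 := A2 Q (z j) P hQX' (by omega)
        exact A2 (z j) Q V (hne _ _ hQX') (by omega)
    by_cases hy : θ < (pos (z j) Y - pos (z j) V).natAbs
    · have e1 := A2 Y (z j) V hYX hy
      refine ih (j - a) (by omega) a j (by omega) (by omega) Y P (z j) U V
        (fun i h1 h2 => hY i h1 (by omega))
        (fun i l h1 h2 h3 h4 => hρ i l h1 (by omega) h3 (by omega)) ?_ ?_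
      · rcases hL with h | ⟨a', h0, h, h1, h2, h3, h4, h5⟩
        · exact Or.inl h
        · have hPX' : ne P (z j) := by rw [h]; exact hD _ (by omega) _ hjn (by omega)
          exact Or.inr ⟨a', h0, h, h1, h2, A2 P (z j) V hPX' (by omega), h4, h5⟩
      · exact Or.inr ⟨hjn, rfl, hYX, hρ j j haj hjb haj hjb.le, hUP, by omega, by omega⟩
    · have e1 := A2 Y (z j) U hYX (by omega)
      refine ih (b - (j + 1)) (by omega) (j + 1) b (by omega) (by omega) Y (z j) Q U V
        (fun i h1 h2 => hY i (by omega) (by omega))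
        (fun i l h1 h2 h3 h4 => hρ i l (by omega) (by omega) (by omega) (by omega)) ?_ ?_
      · refine Or.inr ⟨j, rfl, rfl, hYX, ?_, hVQ, by omega, by omega⟩
        rw [hV' j hjn]; exact hρ j _ haj hjb (by omega) (by omega)
      · rcases hR with h | ⟨h0, h, h1, h2, h3, h4, h5⟩
        · exact Or.inl h
        · have hQX' : ne Q (z j) := by rw [h]; exact hD _ (by omega) _ hjn (by omega)
          exact Or.inr ⟨h0, h, h1, h2, A2 Q (z j) U hQX' (by omega), h4, h5⟩
  · -- both anchors project to the middle of the top axis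
    have hP : (pos (z j) (q a) - pos (z j) P).natAbs ≤
        (pos (z j) (q (j + 1)) - pos (z j) P).natAbs + θ := by
      rcases hL with ⟨h, h'⟩ | ⟨a', h0, h, h1, h2, h3, h4, h5⟩
      · subst h; omega
      · have hPX' : ne P (z j) := by rw [h]; exact hD _ (by omega) _ hjn (by omega)
        refine A4 (z j) P (q a) (q (j + 1)) (hne _ _ hPX') ?_ ?_
        · rw [h, h0, hV' a' (by omega)]; exact hV _ (by omega) _ (by omega)
        · rw [hV' j hjn]; exact hV _ (by omega) _ (by omega)
    have hQ : (pos (z j) (q b) - pos (z j) Q).natAbs ≤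
        (pos (z j) (q j) - pos (z j) Q).natAbs + θ := by
      rcases hR with ⟨h, h'⟩ | ⟨h0, h, h1, h2, h3, h4, h5⟩
      · subst h; omega
      · have hQX' : ne Q (z j) := by rw [h]; exact hD _ (by omega) _ hjn (by omega)
        refine A4 (z j) Q (q b) (q j) (hne _ _ hQX') ?_ ?_
        · rw [h]; exact hV _ (by omega) _ (by omega)
        · exact hV _ (by omega) _ (by omega)
    have hfP := far_from_ends θ hθ _ _ _ _ _ _ hTj hl hr (not_le.1 hbig) hQ
    have hfQ : 25 * θ ≤ (pos (z j) (q b) - pos (z j) Q).natAbs :=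
      far_from_ends θ hθ _ (pos (z j) (q (j + 1))) (pos (z j) (q j)) (pos (z j) (q a)) _
        (pos (z j) P) (by omega) (by omega) (by omega) (by omega) hP
    clear hP hQ hTj hl hr
    have hPY : (pos Y (z j) - pos Y P).natAbs ≤ 2 * θ ∧ (pos Y U - pos Y P).natAbs ≤ θ := by
      rcases hL with ⟨h, h'⟩ | ⟨a', h0, h, h1, h2, h3, h4, h5⟩
      · exfalso; subst h; omega
      · refine ⟨?_, h5⟩
        by_cases hy : θ < (pos (z j) Y - pos (z j) P).natAbs
        · have := A2 Y (z j) P hYX hy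
          omega
        · have e1 := A2 Y (z j) (q a) hYX (by omega)
          have e2 := A3 Y P (q a) h1 h2
          omega
    have hQY : (pos Y (z j) - pos Y Q).natAbs ≤ 2 * θ ∧ (pos Y V - pos Y Q).natAbs ≤ θ := by
      rcases hR with ⟨h, h'⟩ | ⟨h0, h, h1, h2, h3, h4, h5⟩
      · exfalso; subst h; omega
      · refine ⟨?_, h5⟩
        by_cases hy : θ < (pos (z j) Y - pos (z j) Q).natAbs
        · have := A2 Y (z j) Q hYX hy; omega
        · have e1 := A2 Y (z j) (q b) hYX (by omega)
          have e2 := A3 Y Q (q b) h1 h2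
          omega
    omega

section Windmill

variable {G : Type*} [Group G]

/-- `u` normalises `γ` up to sign. -/
def Flips (γ u : G) : Prop := u * γ * u⁻¹ = γ ∨ u * γ * u⁻¹ = γ⁻¹

theorem Flips.inv {γ u : G} (h : Flips γ u) : Flips γ u⁻¹ := by
  rcases h with h | h
  · left
    calc u⁻¹ * γ * u⁻¹⁻¹ = u⁻¹ * (u * γ * u⁻¹) * u := by rw [h]; group
      _ = γ := by group
  · right
    calc u⁻¹ * γ * u⁻¹⁻¹ = u⁻¹ * (u * γ * u⁻¹)⁻¹ * u := by rw [h]; group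
      _ = γ⁻¹ := by group

theorem Flips.zpow_mul {γ u : G} (h : Flips γ u) (m : ℤ) : Flips γ (γ ^ m * u) := by
  have e : γ ^ m * u * γ * (γ ^ m * u)⁻¹ = γ ^ m * (u * γ * u⁻¹) * (γ ^ m)⁻¹ := by group
  unfold Flips
  rw [e]
  rcases h with h | h
  · left; rw [h]; group
  · right; rw [h]; group

theorem flips_zpow_mul_iff {γ u : G} (m : ℤ) : Flips γ (γ ^ m * u) ↔ Flips γ u := by
  refine ⟨fun h => ?_, fun h => h.zpow_mul m⟩
  have := h.zpow_mul (-m)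
  rwa [← mul_assoc, ← zpow_add, neg_add_cancel, zpow_zero, one_mul] at this

/-- The conjugate `f γ ^ (L m) f⁻¹`. -/
def conjPow (γ : G) (L : ℤ) (p : G × ℤ) : G := p.1 * γ ^ (L * p.2) * p.1⁻¹

theorem Flips.zpow {γ u : G} (h : Flips γ u) (n : ℤ) :
    ∃ n' : ℤ, (n' = n ∨ n' = -n) ∧ u * γ ^ n * u⁻¹ = γ ^ n' := by
  rw [← conj_zpow]
  rcases h with h | h
  · exact ⟨n, Or.inl rfl, by rw [h]⟩
  · exact ⟨-n, Or.inr rfl, by rw [h]; simp⟩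

theorem exists_merge {γ : G} (L : ℤ) (p p' : G × ℤ) (h : Flips γ (p.1⁻¹ * p'.1)) :
    ∃ r : G × ℤ, conjPow γ L r = conjPow γ L p * conjPow γ L p' := by
  obtain ⟨f, m⟩ := p
  obtain ⟨f', m'⟩ := p'
  dsimp only at h
  have key : ∀ e : G, (f⁻¹ * f') * γ ^ (L * m') * (f⁻¹ * f')⁻¹ = e →
      f' * γ ^ (L * m') * f'⁻¹ = f * e * f⁻¹ := by
    rintro _ rfl; group
  obtain ⟨n', hn, h⟩ := h.zpow (L * m')
  have e : ∃ d, n' = L * d := by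
    rcases hn with rfl | rfl
    · exact ⟨m', rfl⟩
    · exact ⟨-m', by ring⟩
  obtain ⟨d, rfl⟩ := e
  refine ⟨(f, m + d), ?_⟩
  simp only [conjPow, key _ h, mul_add, zpow_add]
  group

/-- The value of a word in conjugates of powers of `γ ^ L`. -/
def evalWord (γ : G) (L : ℤ) (l : List (G × ℤ)) : G := (l.map (conjPow γ L)).prod

theorem evalWord_append (γ : G) (L : ℤ) (l l' : List (G × ℤ)) :
    evalWord γ L (l ++ l') = evalWord γ L l * evalWord γ L l' := by
  simp [evalWord]

theorem evalWord_cons (γ : G) (L : ℤ) (p : G × ℤ) (l : List (G × ℤ)) :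
    evalWord γ L (p :: l) = conjPow γ L p * evalWord γ L l := by
  simp [evalWord]

theorem exists_word_of_mem_normalClosure (γ : G) (L : ℤ) (h : G)
    (hh : h ∈ Subgroup.normalClosure {γ ^ L}) : ∃ l, evalWord γ L l = h := by
  unfold Subgroup.normalClosure at hh
  induction hh using Subgroup.closure_induction with
  | mem x hx =>
    obtain ⟨a, ha, hx⟩ := Group.mem_conjugatesOfSet_iff.1 hx
    obtain rfl := Set.mem_singleton_iff.1 ha
    obtain ⟨c, rfl⟩ := isConj_iff.1 hx
    exact ⟨[(c, 1)], by simp [evalWord, conjPow]⟩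
  | one => exact ⟨[], rfl⟩
  | mul x y _ _ hx hy =>
    obtain ⟨l, rfl⟩ := hx
    obtain ⟨l', rfl⟩ := hy
    exact ⟨l ++ l', evalWord_append _ _ _ _⟩
  | inv x _ hx =>
    obtain ⟨l, rfl⟩ := hx
    refine ⟨(l.map fun p => (p.1, -p.2)).reverse, ?_⟩
    clear * -
    induction l with
    | nil => simp [evalWord]
    | cons p l ih =>
      rw [List.map_cons, List.reverse_cons, evalWord_append, ih, evalWord_cons, evalWord_cons]
      simp [evalWord, conjPow, mul_assoc]

/-- Words for `h` minimising first the length and then a cost. -/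
theorem exists_minimal_word (γ : G) (L : ℤ) (c : G → ℕ) (h : G)
    (hh : ∃ l, evalWord γ L l = h) :
    ∃ l, evalWord γ L l = h ∧ (∀ l', evalWord γ L l' = h → l.length ≤ l'.length) ∧
      ∀ l', evalWord γ L l' = h → l'.length = l.length →
        (l.map fun p => c p.1).sum ≤ (l'.map fun p => c p.1).sum := by
  classical
  have h1 : ∃ n, ∃ l, evalWord γ L l = h ∧ l.length = n := by
    obtain ⟨l, hl⟩ := hh; exact ⟨_, l, hl, rfl⟩
  have h2 : ∃ s, ∃ l, evalWord γ L l = h ∧ l.length = Nat.find h1 ∧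
      (l.map fun p => c p.1).sum = s := by
    obtain ⟨l, hl, hl'⟩ := Nat.find_spec h1; exact ⟨_, l, hl, hl', rfl⟩
  obtain ⟨l, hl, hl', hs⟩ := Nat.find_spec h2
  refine ⟨l, hl, fun l' e => ?_, fun l' e e' => ?_⟩
  · rw [hl']; exact Nat.find_min' h1 ⟨l', e, rfl⟩
  · rw [hs]; exact Nat.find_min' h2 ⟨l', e, e'.trans hl', rfl⟩

/-- Minimality of a word, for the cost `c` of the conjugators. -/
structure IsMinimalWord (γ : G) (L : ℤ) (c : G → ℕ) (l : List (G × ℤ)) : Prop where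
  length_le : ∀ l', evalWord γ L l' = evalWord γ L l → l.length ≤ l'.length
  cost_le : ∀ l', evalWord γ L l' = evalWord γ L l → l'.length = l.length →
    (l.map fun p => c p.1).sum ≤ (l'.map fun p => c p.1).sum

namespace IsMinimalWord

variable {γ : G} {L : ℤ} {c : G → ℕ} {l : List (G × ℤ)}

theorem cost_le_right (h : IsMinimalWord γ L c l) {A W B : List (G × ℤ)} {p : G × ℤ}
    (hl : l = A ++ p :: (W ++ B)) : c p.1 ≤ c ((evalWord γ L W)⁻¹ * p.1) := by
  subst hl
  have := h.cost_le (A ++ (W ++ ((evalWord γ L W)⁻¹ * p.1, p.2) :: B))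
    (by simp only [evalWord_append, evalWord_cons, conjPow]; group)
    (by simp; omega)
  simp at this
  omega

theorem cost_le_left (h : IsMinimalWord γ L c l) {A W B : List (G × ℤ)} {p : G × ℤ}
    (hl : l = A ++ (W ++ p :: B)) : c p.1 ≤ c (evalWord γ L W * p.1) := by
  subst hl
  have := h.cost_le (A ++ (evalWord γ L W * p.1, p.2) :: (W ++ B))
    (by simp only [evalWord_append, evalWord_cons, conjPow]; group)
    (by simp; omega)
  simp at this
  omega

theorem not_flips (h : IsMinimalWord γ L c l) {A W B : List (G × ℤ)} {p p' : G × ℤ}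
    (hl : l = A ++ p :: (W ++ p' :: B)) : ¬ Flips γ (p.1⁻¹ * evalWord γ L W * p'.1) := by
  subst hl
  intro hf
  obtain ⟨r, hr⟩ := exists_merge L ((evalWord γ L W)⁻¹ * p.1, p.2) p' (by simpa using hf)
  have := h.length_le (A ++ (W ++ r :: B))
    (by simp only [evalWord_append, evalWord_cons, hr]; simp only [conjPow]; group)
  simp at this

theorem exponent_ne_zero (h : IsMinimalWord γ L c l) {A B : List (G × ℤ)} {p : G × ℤ}
    (hl : l = A ++ p :: B) : p.2 ≠ 0 := by
  subst hl
  intro hp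
  have := h.length_le (A ++ B)
    (by simp only [evalWord_append, evalWord_cons, conjPow, hp]; simp)
  simp at this

end IsMinimalWord

/-- Words for `h` minimising first the length and then a cost. -/
theorem exists_isMinimalWord (γ : G) (L : ℤ) (c : G → ℕ) (h : G)
    (hh : ∃ l, evalWord γ L l = h) : ∃ l, evalWord γ L l = h ∧ IsMinimalWord γ L c l := by
  obtain ⟨l, hl, h1, h2⟩ := exists_minimal_word γ L c h hh
  exact ⟨l, hl, ⟨fun l' e => h1 l' (e.trans hl), fun l' e => h2 l' (e.trans hl)⟩⟩

theorem exists_far_projection (γ : G) (L : ℕ) (P : G → ℤ) (ρ : G → ℕ) (θ : ℕ) (hθ : 1 ≤ θ)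
    (hρ : ∀ (m : ℤ) q, ρ (γ ^ m * q) = ρ q)
    (hP : ∀ (m : ℤ) q, m ≠ 0 → 100 * θ ≤ (P q - P (γ ^ (L * m) * q)).natAbs)
    (A2 : ∀ f f' w : G, ¬ Flips γ (f⁻¹ * f') →
      θ < (P (f'⁻¹ * f) - P (f'⁻¹ * w)).natAbs → (P (f⁻¹ * f') - P (f⁻¹ * w)).natAbs ≤ θ)
    (A3 : ∀ f f' q : G, ¬ Flips γ (f⁻¹ * f') → ρ (f'⁻¹ * q) ≤ ρ (f⁻¹ * q) →
      (P (f⁻¹ * q) - P (f⁻¹ * f')).natAbs ≤ θ)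
    (A4 : ∀ f f' q q' : G, ¬ Flips γ (f⁻¹ * f') → ρ (f'⁻¹ * q) ≤ ρ (f'⁻¹ * q') →
      ρ (f⁻¹ * q') ≤ ρ (f⁻¹ * q) →
      (P (f⁻¹ * q) - P (f⁻¹ * f')).natAbs ≤ (P (f⁻¹ * q') - P (f⁻¹ * f')).natAbs + θ)
    (h : G) (hh : h ∈ Subgroup.normalClosure {γ ^ (L : ℤ)}) (h1 : h ≠ 1) :
    ∃ z : G, 88 * θ ≤ (P z⁻¹ - P (z⁻¹ * h)).natAbs := by
  obtain ⟨l, hl, hmin⟩ := exists_isMinimalWord γ L (fun f => ρ f⁻¹) h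
    (exists_word_of_mem_normalClosure γ L h hh)
  obtain ⟨n, hn⟩ : ∃ n, l.length = n := ⟨_, rfl⟩
  have hn0 : 0 < n := by
    rcases Nat.eq_zero_or_pos n with h0 | h0
    · rw [h0] at hn
      exact absurd (by rw [← hl, List.length_eq_zero_iff.1 hn]; rfl) h1
    · exact h0
  obtain ⟨q, hq⟩ : ∃ q : ℕ → G, ∀ i, q i = evalWord γ L (l.take i) := ⟨_, fun _ => rfl⟩
  obtain ⟨p, hp⟩ : ∃ p : ℕ → G × ℤ, ∀ i, p i = l.getD i (1, 0) := ⟨_, fun _ => rfl⟩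
  obtain ⟨z, hz⟩ : ∃ z : ℕ → G, ∀ i, z i = q i * (p i).1 := ⟨_, fun _ => rfl⟩
  have drop1 : ∀ i < n, l.drop i = p i :: l.drop (i + 1) := by
    intro i hi
    have hi' : i < l.length := by omega
    rw [hp, List.getD_eq_getElem _ _ hi', List.drop_eq_getElem_cons]
  have split1 : ∀ i < n, l = l.take i ++ p i :: l.drop (i + 1) := by
    intro i hi
    rw [← drop1 i hi, List.take_append_drop]
  have hq1 : ∀ i < n, q (i + 1) = q i * conjPow γ L (p i) := by
    intro i hi
    have hi' : i < l.length := by omega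
    rw [hq, hq, hp, List.getD_eq_getElem _ _ hi', List.take_succ_eq_append_getElem hi',
      evalWord_append]
    simp [evalWord]
  have split2 : ∀ i j, i ≤ j → ∃ W, l.drop i = W ++ l.drop j ∧
      q j = q i * evalWord γ L W := by
    intro i j hij
    refine ⟨(l.drop i).take (j - i), ?_, ?_⟩
    · conv_lhs => rw [← List.take_append_drop (j - i) (l.drop i)]
      rw [List.drop_drop, Nat.add_sub_cancel' hij]
    · rw [hq, hq, ← evalWord_append]
      congr 1
      rw [← List.take_add, Nat.add_sub_cancel' hij]
  have hzq : ∀ i, (z i)⁻¹ * q i = (p i).1⁻¹ := by intro i; rw [hz]; group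
  have hzq1 : ∀ i < n, (z i)⁻¹ * q (i + 1) = γ ^ ((L : ℤ) * (p i).2) * (p i).1⁻¹ := by
    intro i hi; rw [hz, hq1 i hi, conjPow]; group
  have hV' : ∀ i < n, ρ ((z i)⁻¹ * q (i + 1)) = ρ ((z i)⁻¹ * q i) := by
    intro i hi
    rw [hzq1 i hi, hρ, hzq]
  have hV : ∀ i < n, ∀ j ≤ n, ρ ((z i)⁻¹ * q i) ≤ ρ ((z i)⁻¹ * q j) := by
    intro i hi j hj
    rcases lt_or_ge i j with hij | hij
    · obtain ⟨W, hW, hqW⟩ := split2 (i + 1) j hij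
      have e := hmin.cost_le_right (A := l.take i) (W := W) (B := l.drop j) (p := p i)
        (by rw [← hW]; exact split1 i hi)
      rw [hzq, hqW, ← mul_assoc, hzq1 i hi, mul_assoc, hρ]
      simpa using e
    · obtain ⟨W, hW, hqW⟩ := split2 j i hij
      have e := hmin.cost_le_left (A := l.take j) (W := W) (B := l.drop (i + 1)) (p := p i)
        (by rw [← drop1 i hi, ← hW, List.take_append_drop])
      have e2 : (z i)⁻¹ * q j = (evalWord γ L W * (p i).1)⁻¹ := by
        rw [hz, hqW]; group
      rw [hzq, e2]
      exact e
  have hT : ∀ i < n, 100 * θ ≤ (P ((z i)⁻¹ * q i) - P ((z i)⁻¹ * q (i + 1))).natAbs := by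
    intro i hi
    rw [hzq1 i hi, hzq]
    exact hP _ _ (hmin.exponent_ne_zero (split1 i hi))
  have hne : ∀ a b : G, ¬ Flips γ (a⁻¹ * b) → ¬ Flips γ (b⁻¹ * a) := by
    intro a b hab hba
    exact hab (by simpa using hba.inv)
  have hDlt : ∀ i j, i < j → j < n → ¬ Flips γ ((z i)⁻¹ * z j) := by
    intro i j hij hj
    obtain ⟨W, hW, hqW⟩ := split2 (i + 1) j hij
    have e := hmin.not_flips (A := l.take i) (W := W) (B := l.drop (j + 1)) (p := p i) (p' := p j)
      (by rw [← drop1 j hj, ← hW]; exact split1 i (by omega))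
    rwa [hz j, hqW, ← mul_assoc, ← mul_assoc, hzq1 i (by omega), mul_assoc, mul_assoc,
      flips_zpow_mul_iff, ← mul_assoc]
  have hD : ∀ i < n, ∀ j < n, i ≠ j → ¬ Flips γ ((z i)⁻¹ * z j) := by
    intro i hi j hj hij
    rcases lt_or_gt_of_ne hij with h | h
    · exact hDlt i j h hj
    · exact hne _ _ (hDlt j i h hi)
  obtain ⟨k, hk, hkmax⟩ := Finset.exists_max_image (Finset.range n)
    (fun i => ρ ((z i)⁻¹ * q i)) ⟨0, by simpa using hn0⟩
  rw [Finset.mem_range] at hk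
  have main := proj_bounded (fun f q => P (f⁻¹ * q)) (fun f q => ρ (f⁻¹ * q))
    (fun f f' => ¬ Flips γ (f⁻¹ * f')) θ hθ hne A2 A3 A4 n q z hV hV' hT hD
  have m1 := main k 0 k (by omega) hk.le (z k) (q 0) (q k) (q 0) (q k)
    (fun i _ hi => hD k hk i (by omega) (by omega))
    (fun i l _ h2 _ h4 => (hkmax i (Finset.mem_range.2 (by omega))).trans (hV k hk l (by omega)))
    (Or.inl ⟨rfl, rfl⟩) (Or.inl ⟨rfl, rfl⟩)
  have m2 := main (n - (k + 1)) (k + 1) n (by omega) le_rfl (z k) (q (k + 1)) (q n)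
    (q (k + 1)) (q n)
    (fun i _ hi => hD k hk i (by omega) (by omega))
    (fun i l _ h2 _ h4 => (hkmax i (Finset.mem_range.2 (by omega))).trans (hV k hk l (by omega)))
    (Or.inl ⟨rfl, rfl⟩) (Or.inl ⟨rfl, rfl⟩)
  have m3 := hT k hk
  have q0 : q 0 = 1 := by rw [hq]; rfl
  have qn : q n = h := by rw [hq, ← hn, List.take_length, hl]
  rw [q0, mul_one] at m1
  rw [qn] at m2
  exact ⟨z k, by clear * - m1 m2 m3; omega⟩

end Windmill

section Loxodromic

variable {G : Type*} [Group G]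

/-- The logarithmic pseudo-distance attached to a length function. -/
noncomputable def logDist (b : G → ℕ) (u v : G) : ℝ := Real.log (b (u⁻¹ * v))

/-- `b` is the exponential of a hyperbolic length function on `G`, for which `g` acts as
a loxodromic element, `g ^ 2` being weakly properly discontinuous in a strong sense. -/
structure IsLoxodromic (b : G → ℕ) (g : G) (δ τ : ℝ) : Prop where
  one_le : ∀ u, 1 ≤ b u
  inv : ∀ u, b u⁻¹ = b u
  mul_le : ∀ u v, b (u * v) ≤ b u * b v
  four_point : ∀ p q r s, logDist b p q + logDist b r s ≤
    max (logDist b p r + logDist b q s) (logDist b p s + logDist b q r) + δ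
  abs_sub_le : ∀ n : ℤ, |Real.log (b (g ^ n)) - |(n : ℝ)| * τ| ≤ δ
  pos : 0 < δ
  le : 1000 * δ ≤ τ
  wpd : ∀ u, (∀ j : ℤ, |j| ≤ 1 → Real.log (b (g ^ (-j) * u * g ^ j)) ≤ τ / 2 + 100 * δ) →
    Flips (g ^ 2) u
  wpd' : ∀ u, (∀ j : ℤ, |j| ≤ 1 → Real.log (b (g ^ (-j) * u * g ^ (-j))) ≤ τ / 2 + 100 * δ) →
    Flips (g ^ 2) u

theorem exists_argmin_axis (b : G → ℕ) (g q : G) :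
    ∃ i : ℤ, ∀ j : ℤ, b (q⁻¹ * g ^ i) ≤ b (q⁻¹ * g ^ j) :=
  ⟨Function.argmin (fun i : ℤ => b (q⁻¹ * g ^ i)), fun j =>
    Function.argmin_le (fun i : ℤ => b (q⁻¹ * g ^ i)) j⟩

/-- The exponent of a point of the axis of `g` closest to `q`. -/
noncomputable def axisProj (b : G → ℕ) (g q : G) : ℤ := (exists_argmin_axis b g q).choose

/-- The exponential of the distance from `q` to the axis of `g`. -/
noncomputable def axisDist (b : G → ℕ) (g q : G) : ℕ := b (q⁻¹ * g ^ axisProj b g q)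

theorem axisDist_le (b : G → ℕ) (g q : G) (j : ℤ) : axisDist b g q ≤ b (q⁻¹ * g ^ j) :=
  (exists_argmin_axis b g q).choose_spec j

theorem logDist_mul_left (b : G → ℕ) (f u v : G) :
    logDist b (f * u) (f * v) = logDist b u v := by
  unfold logDist; congr 3; group

theorem logDist_inv_mul (b : G → ℕ) (f u v : G) :
    logDist b (f⁻¹ * u) v = logDist b u (f * v) := by
  unfold logDist; congr 3; group

namespace IsLoxodromic

variable {b : G → ℕ} {g : G} {δ τ : ℝ}

theorem symm (h : IsLoxodromic b g δ τ) (u v : G) : logDist b u v = logDist b v u := by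
  unfold logDist
  rw [← h.inv]; congr 3; group

theorem triangle (h : IsLoxodromic b g δ τ) (u v w : G) :
    logDist b u w ≤ logDist b u v + logDist b v w := by
  unfold logDist
  have h1 : (0 : ℝ) < b (u⁻¹ * v) := by exact_mod_cast h.one_le _
  have h2 : (0 : ℝ) < b (v⁻¹ * w) := by exact_mod_cast h.one_le _
  have h3 : (0 : ℝ) < b (u⁻¹ * w) := by exact_mod_cast h.one_le _
  rw [← Real.log_mul h1.ne' h2.ne']
  apply Real.log_le_log h3
  have := h.mul_le (u⁻¹ * v) (v⁻¹ * w)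
  rw [show u⁻¹ * v * (v⁻¹ * w) = u⁻¹ * w by group] at this
  exact_mod_cast this

theorem axis_bounds (h : IsLoxodromic b g δ τ) (i j : ℤ) :
    |((j : ℝ) - i)| * τ - δ ≤ logDist b (g ^ i) (g ^ j) ∧
      logDist b (g ^ i) (g ^ j) ≤ |((j : ℝ) - i)| * τ + δ := by
  have := abs_le.1 (h.abs_sub_le (j - i))
  rw [show g ^ (j - i) = (g ^ i)⁻¹ * g ^ j by rw [zpow_sub]; group] at this
  push_cast at this
  unfold logDist
  constructor <;> linarith [this.1, this.2]

theorem logDist_proj_le (h : IsLoxodromic b g δ τ) (q : G) (j : ℤ) :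
    logDist b q (g ^ axisProj b g q) ≤ logDist b q (g ^ j) := by
  unfold logDist
  apply Real.log_le_log (by exact_mod_cast h.one_le _)
  exact_mod_cast axisDist_le b g q j

theorem le_logDist_axis (h : IsLoxodromic b g δ τ) (q : G) (j : ℤ) :
    logDist b q (g ^ axisProj b g q) + |((j : ℝ) - axisProj b g q)| * τ - τ - 3 * δ ≤
      logDist b q (g ^ j) := by
  have hδ := h.pos
  have hτ := h.le
  generalize hP : axisProj b g q = p
  have hmin : ∀ j : ℤ, logDist b q (g ^ p) ≤ logDist b q (g ^ j) := by
    intro j; rw [← hP]; exact h.logDist_proj_le q j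
  have key : ∀ ε : ℤ, |(ε : ℝ)| = 1 → |((j : ℝ) - (p + ε))| = |((j : ℝ) - p)| - 1 →
      logDist b q (g ^ p) + |((j : ℝ) - p)| * τ - τ - 3 * δ ≤ logDist b q (g ^ j) := by
    intro ε hε hj
    have h4 := h.four_point q (g ^ (p + ε)) (g ^ p) (g ^ j)
    have b1 := h.axis_bounds p j
    have b2 := h.axis_bounds (p + ε) j
    have b3 := h.axis_bounds (p + ε) p
    push_cast at b2 b3
    rw [hj] at b2
    rw [show ((p : ℝ) - (p + ε)) = -ε by ring, abs_neg, hε] at b3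
    have := hmin (p + ε)
    rcases max_cases (logDist b q (g ^ p) + logDist b (g ^ (p + ε)) (g ^ j))
      (logDist b q (g ^ j) + logDist b (g ^ (p + ε)) (g ^ p)) with ⟨e, -⟩ | ⟨e, -⟩ <;>
      rw [e] at h4 <;> linarith
  rcases lt_trichotomy j p with hj | hj | hj
  · refine key (-1) (by norm_num) ?_
    have : (j : ℝ) + 1 ≤ p := by exact_mod_cast hj
    rw [abs_of_nonpos (by push_cast; linarith), abs_of_nonpos (by linarith)]
    push_cast; ring
  · subst hj; simp; linarith
  · refine key 1 (by norm_num) ?_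
    have : (p : ℝ) + 1 ≤ j := by exact_mod_cast hj
    rw [abs_of_nonneg (by push_cast; linarith), abs_of_nonneg (by linarith)]
    push_cast; ring

theorem logDist_axis_le (h : IsLoxodromic b g δ τ) (q : G) (i j : ℤ) :
    logDist b q (g ^ j) ≤ logDist b q (g ^ i) + |((j : ℝ) - i)| * τ + δ := by
  linarith [h.triangle q (g ^ i) (g ^ j), (h.axis_bounds i j).2]

theorem two_mul_tau_le (h : IsLoxodromic b g δ τ) {x y : ℤ} {n : ℕ} (hn : n ≤ (x - y).natAbs) :
    (n : ℝ) * τ ≤ |((x : ℝ) - y)| * τ := by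
  have hτ : 0 ≤ τ := by linarith [h.pos, h.le]
  apply mul_le_mul_of_nonneg_right _ hτ
  have : ((x - y).natAbs : ℝ) = |((x : ℝ) - y)| := by
    rw [Nat.cast_natAbs]; push_cast; rfl
  rw [← this]
  exact_mod_cast hn

/-- Points with far apart projections are joined through the axis. -/
theorem le_logDist (h : IsLoxodromic b g δ τ) (q q' : G)
    (hn : 2 ≤ (axisProj b g q - axisProj b g q').natAbs) :
    logDist b q (g ^ axisProj b g q) + |((axisProj b g q : ℝ) - axisProj b g q')| * τ +
      logDist b q' (g ^ axisProj b g q') - 3 * τ ≤ logDist b q q' := by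
  have hδ := h.pos
  have hτ := h.le
  have e := h.two_mul_tau_le hn
  have b1 := h.le_logDist_axis q (axisProj b g q')
  have b2 := h.le_logDist_axis q' (axisProj b g q)
  generalize axisProj b g q = p at *
  generalize axisProj b g q' = p' at *
  have h4 := h.four_point q (g ^ p') (g ^ p) q'
  rw [h.symm (g ^ p') q', h.symm (g ^ p) q'] at h4
  have b3 := h.axis_bounds p' p
  rw [abs_sub_comm (p' : ℝ)] at b1
  push_cast at e
  rcases max_cases (logDist b q (g ^ p) + logDist b q' (g ^ p'))
      (logDist b q q' + logDist b (g ^ p') (g ^ p)) with ⟨e, -⟩ | ⟨e, -⟩ <;>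
      rw [e] at h4 <;> linarith

theorem natAbs_proj_sub_le (h : IsLoxodromic b g δ τ) (q : G) (i : ℤ)
    (hi : ∀ j : ℤ, b (q⁻¹ * g ^ i) ≤ b (q⁻¹ * g ^ j)) : (axisProj b g q - i).natAbs ≤ 1 := by
  by_contra hc
  have e := h.two_mul_tau_le (not_le.1 hc)
  have b1 := h.le_logDist_axis q i
  have hi' : logDist b q (g ^ i) ≤ logDist b q (g ^ axisProj b g q) := by
    unfold logDist
    apply Real.log_le_log (by exact_mod_cast h.one_le _)
    exact_mod_cast hi _
  rw [abs_sub_comm] at b1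
  push_cast at e
  linarith [h.pos, h.le]

theorem natAbs_proj_zpow_mul (h : IsLoxodromic b g δ τ) (q : G) (j : ℤ) :
    (axisProj b g (g ^ j * q) - (axisProj b g q + j)).natAbs ≤ 1 := by
  apply h.natAbs_proj_sub_le
  intro i
  have e : ∀ i : ℤ, (g ^ j * q)⁻¹ * g ^ i = q⁻¹ * g ^ (i - j) := by
    intro i; rw [zpow_sub]; group
  rw [e, e, add_sub_cancel_right]
  exact axisDist_le b g q _

theorem axisDist_zpow_mul (b : G → ℕ) (g q : G) (j : ℤ) :
    axisDist b g (g ^ j * q) = axisDist b g q := by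
  have e : ∀ i : ℤ, (g ^ j * q)⁻¹ * g ^ i = q⁻¹ * g ^ (i - j) := by
    intro i; rw [zpow_sub]; group
  apply le_antisymm
  · have := axisDist_le b g (g ^ j * q) (axisProj b g q + j)
    rwa [e, add_sub_cancel_right] at this
  · have := axisDist_le b g q (axisProj b g (g ^ j * q) - j)
    rwa [← e] at this

/-- Deep points of the axis are close to geodesics between points with far projections. -/
theorem deep_point (h : IsLoxodromic b g δ τ) (y y' : G) (m : ℤ)
    (h1 : 1 ≤ (m - axisProj b g y).natAbs) (h2 : 1 ≤ (m - axisProj b g y').natAbs)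
    (h3 : (axisProj b g y' - axisProj b g y).natAbs =
      (m - axisProj b g y).natAbs + (axisProj b g y' - m).natAbs) :
    (logDist b y (g ^ m) + |((axisProj b g y' : ℝ) - m)| * τ ≤
      logDist b y (g ^ axisProj b g y') + 3 * δ) ∧
    logDist b y (g ^ m) + logDist b y' (g ^ m) ≤ logDist b y y' + 5 * δ := by
  have hδ := h.pos
  have hτ := h.le
  have b1 := h.le_logDist_axis y m
  have b2 := h.le_logDist_axis y' m
  have e1 := h.two_mul_tau_le h1
  have e2 := h.two_mul_tau_le h2
  have e3 : |((axisProj b g y' : ℝ) - axisProj b g y)| =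
    |((m : ℝ) - axisProj b g y)| + |((axisProj b g y' : ℝ) - m)| := by
    have := congrArg (Nat.cast : ℕ → ℝ) h3
    push_cast [Nat.cast_natAbs] at this
    exact this
  generalize axisProj b g y = p at *
  generalize axisProj b g y' = p' at *
  have e4 := congrArg (· * τ) e3
  simp only [add_mul] at e4
  push_cast at e1 e2
  have a1 := h.axis_bounds p p'
  have a2 := h.axis_bounds m p'
  have a3 := h.axis_bounds m p
  have f4 := h.four_point (g ^ m) y (g ^ p) (g ^ p')
  have f4' := h.four_point (g ^ m) y' y (g ^ p')
  rw [abs_sub_comm (p : ℝ)] at a3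
  rw [abs_sub_comm (m : ℝ) p'] at b2 e2
  rw [h.symm (g ^ m) y] at f4 f4'
  rw [h.symm (g ^ m) y', h.symm y' y] at f4'
  have s1 : logDist b y (g ^ m) + |(p' : ℝ) - m| * τ ≤ logDist b y (g ^ p') + 3 * δ := by
    rcases max_cases (logDist b (g ^ m) (g ^ p) + logDist b y (g ^ p'))
      (logDist b (g ^ m) (g ^ p') + logDist b y (g ^ p)) with ⟨e, -⟩ | ⟨e, -⟩ <;>
      rw [e] at f4 <;> linarith
  refine ⟨s1, ?_⟩
  rcases max_cases (logDist b y (g ^ m) + logDist b y' (g ^ p'))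
      (logDist b (g ^ m) (g ^ p') + logDist b y y') with ⟨e, -⟩ | ⟨e, -⟩ <;>
      rw [e] at f4' <;> linarith

/-- A point close to a geodesic between two points of a translated axis is close to it. -/
theorem close_to_axis (h : IsLoxodromic b g δ τ) (u y : G) (i j r : ℤ) (hir : i ≤ r)
    (hrj : r ≤ j) (hy : logDist b (u * g ^ i) y + logDist b (u * g ^ j) y ≤
      logDist b (u * g ^ i) (u * g ^ j) + 5 * δ) :
    logDist b y (u * g ^ r) ≤
      |logDist b (u * g ^ i) y - ((r : ℝ) - i) * τ| + 9 * δ := by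
  have f4 := h.four_point y (u * g ^ r) (u * g ^ i) (u * g ^ j)
  have b1 := h.axis_bounds i j
  have b2 := h.axis_bounds r i
  have b3 := h.axis_bounds r j
  rw [← logDist_mul_left b u] at b1 b2 b3
  have c1 : (i : ℝ) ≤ r := by exact_mod_cast hir
  have c2 : (r : ℝ) ≤ j := by exact_mod_cast hrj
  rw [abs_of_nonneg (by linarith)] at b1 b3
  rw [abs_of_nonpos (by linarith)] at b2
  rw [h.symm y (u * g ^ i), h.symm y (u * g ^ j)] at f4
  have d1 := le_abs_self (logDist b (u * g ^ i) y - ((r : ℝ) - i) * τ)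
  have d2 := neg_abs_le (logDist b (u * g ^ i) y - ((r : ℝ) - i) * τ)
  have hδ := h.pos
  rcases max_cases (logDist b (u * g ^ i) y + logDist b (u * g ^ r) (u * g ^ j))
      (logDist b (u * g ^ j) y + logDist b (u * g ^ r) (u * g ^ i)) with ⟨e, -⟩ | ⟨e, -⟩ <;>
      rw [e] at f4 <;> nlinarith

theorem flips_of_conj {v : G} (m r : ℤ) (hv : Flips (g ^ 2) (g ^ (-m) * v * g ^ r)) :
    Flips (g ^ 2) v := by
  have e : v * g ^ 2 * v⁻¹ =
      g ^ m * (g ^ (-m) * v * g ^ r * g ^ 2 * (g ^ (-m) * v * g ^ r)⁻¹) * g ^ (-m) := by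
    group
  rcases hv with hv | hv
  · left; rw [e, hv]; group
  · right; rw [e, hv]; group

theorem natAbs_proj_axis_le (h : IsLoxodromic b g δ τ) (u : G) (hu : ¬ Flips (g ^ 2) u) (i j : ℤ) :
    (axisProj b g (u * g ^ i) - axisProj b g (u * g ^ j)).natAbs ≤ 20 := by
  have hδ := h.pos
  have hτ := h.le
  wlog hij : i ≤ j generalizing i j with H
  · rw [natAbs_sub_symm]; exact H j i (le_of_not_ge hij)
  by_contra hc
  apply hu
  obtain ⟨y, hy⟩ : ∃ y, y = u * g ^ i := ⟨_, rfl⟩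
  obtain ⟨y', hy'⟩ : ∃ y', y' = u * g ^ j := ⟨_, rfl⟩
  rw [← hy, ← hy'] at hc
  obtain ⟨p, hp⟩ : ∃ p, p = axisProj b g y := ⟨_, rfl⟩
  obtain ⟨p', hp'⟩ : ∃ p', p' = axisProj b g y' := ⟨_, rfl⟩
  obtain ⟨σ, n, hσ, hn, hpn⟩ : ∃ σ n : ℤ, (σ = 1 ∨ σ = -1) ∧ 21 ≤ n ∧ p' = p + σ * n := by
    rw [← hp, ← hp'] at hc
    rcases le_total p p' with hle | hle
    · exact ⟨1, p' - p, Or.inl rfl, by omega, by omega⟩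
    · exact ⟨-1, p - p', Or.inr rfl, by omega, by omega⟩
  obtain ⟨d, hd⟩ : ∃ d : ℤ → ℝ, ∀ t, d t = logDist b y (g ^ (p + σ * (10 + t))) :=
    ⟨_, fun _ => rfl⟩
  have hnR : (21 : ℝ) ≤ n := by exact_mod_cast hn
  have abs1 : ∀ t : ℤ, |t| ≤ 1 → |((p' : ℝ) - (p + σ * (10 + t) : ℤ))| = n - 10 - t := by
    intro t ht
    have ht' : (t : ℝ) ≤ 1 := by exact_mod_cast (abs_le.1 ht).2
    have hpR : (p' : ℝ) = p + σ * n := by exact_mod_cast hpn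
    rw [hpR]
    rcases hσ with rfl | rfl
    · rw [abs_of_nonneg (by push_cast; linarith)]; push_cast; ring
    · rw [abs_of_nonpos (by push_cast; linarith)]; push_cast; ring
  have deep : ∀ t : ℤ, |t| ≤ 1 → (d t + (n - 10 - t) * τ ≤ logDist b y (g ^ p') + 3 * δ) ∧
      d t + logDist b y' (g ^ (p + σ * (10 + t))) ≤ logDist b y y' + 5 * δ := by
    intro t ht
    have ht' := abs_le.1 ht
    have := h.deep_point y y' (p + σ * (10 + t)) (by rw [← hp]; rcases hσ with rfl | rfl <;> omega)
      (by rw [← hp']; rcases hσ with rfl | rfl <;> omega)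
      (by rw [← hp, ← hp']; rcases hσ with rfl | rfl <;> omega)
    rw [← hp', abs1 t ht, ← hd] at this
    exact this
  have hd0 : ∀ t : ℤ, |t| ≤ 1 → logDist b y (g ^ p') ≤ d t + (n - 10 - t) * τ + δ := by
    intro t ht
    have := h.logDist_axis_le y (p + σ * (10 + t)) p'
    rwa [abs1 t ht, ← hd] at this
  have h0 : |(0 : ℤ)| ≤ 1 := by simp
  have low : 9 * τ - 3 * δ ≤ d 0 := by
    have := h.le_logDist_axis y (p + σ * (10 + 0))
    rw [← hd, ← hp] at this
    have e : |(((p + σ * (10 + 0) : ℤ) : ℝ) - p)| = 10 := by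
      rcases hσ with rfl | rfl <;> push_cast <;> norm_num
    rw [e] at this
    have : 0 ≤ logDist b y (g ^ p) := Real.log_natCast_nonneg _
    linarith
  have high : d 0 ≤ ((j : ℝ) - i) * τ - 9 * τ := by
    have e1 := h.le_logDist_axis y' (p + σ * (10 + 0))
    rw [← hp', abs_sub_comm, abs1 0 h0] at e1
    have e2 := (deep 0 h0).2
    have e3 := (h.axis_bounds i j).2
    rw [← logDist_mul_left b u, ← hy, ← hy', abs_of_nonneg
      (by have : (i : ℝ) ≤ j := by exact_mod_cast hij
          linarith)] at e3
    have : 0 ≤ logDist b y' (g ^ p') := Real.log_natCast_nonneg _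
    push_cast at e1 e2
    nlinarith
  obtain ⟨e, he⟩ : ∃ e : ℤ, |d 0 - e * τ| ≤ τ / 2 := by
    have hτ0 : 0 < τ := by linarith
    refine ⟨round (d 0 / τ), ?_⟩
    have := abs_sub_round (d 0 / τ)
    have e2 : d 0 - round (d 0 / τ) * τ = (d 0 / τ - round (d 0 / τ)) * τ := by
      field_simp
    rw [e2, abs_mul, abs_of_pos hτ0]
    nlinarith
  have he' := abs_le.1 he
  have hτ0 : 0 < τ := by linarith
  have e1 : 1 ≤ e := by
    by_contra hcon
    have : (e : ℝ) ≤ 0 := by exact_mod_cast Int.lt_add_one_iff.1 (not_le.1 hcon)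
    nlinarith
  have e2 : e + 1 ≤ j - i := by
    by_contra hcon
    have : ((j : ℝ) - i) ≤ e := by exact_mod_cast Int.lt_add_one_iff.1 (not_le.1 hcon)
    nlinarith
  have close : ∀ t : ℤ, |t| ≤ 1 →
      logDist b (g ^ (p + σ * (10 + t))) (u * g ^ (i + e + t)) ≤ τ / 2 + 100 * δ := by
    intro t ht
    have ht' := abs_le.1 ht
    have := h.close_to_axis u (g ^ (p + σ * (10 + t))) i j (i + e + t) (by omega) (by omega)
      (by rw [← hy, ← hy', ← hd]; exact (deep t ht).2)
    rw [← hy, ← hd] at this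
    have c1 := (deep t ht).1
    have c2 := (deep 0 h0).1
    have c3 := hd0 t ht
    have c4 := hd0 0 h0
    have c5 : |d t - (((i + e + t : ℤ) : ℝ) - i) * τ| ≤ τ / 2 + 4 * δ := by
      push_cast at *
      rw [abs_le]
      constructor <;> nlinarith
    linarith
  apply flips_of_conj (p + σ * 10) (i + e)
  rcases hσ with rfl | rfl
  · apply h.wpd
    intro t ht
    convert close t ht using 1
    unfold logDist
    congr 3
    simp only [mul_assoc, ← zpow_add, ← zpow_neg]
    simp only [← mul_assoc, ← zpow_add]
    ring_nf
  · apply h.wpd'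
    intro t ht
    convert close (-t) (by rwa [abs_neg]) using 1
    unfold logDist
    congr 3
    simp only [mul_assoc, ← zpow_add, ← zpow_neg]
    simp only [← mul_assoc, ← zpow_add]
    ring_nf

theorem natAbs_proj_inv_le (h : IsLoxodromic b g δ τ) (u : G) (hu : ¬ Flips (g ^ 2) u) (i : ℤ) :
    (axisProj b g (u * g ^ i) - axisProj b g u).natAbs ≤ 20 := by
  simpa using h.natAbs_proj_axis_le u hu i 0

theorem le_add_logDist (h : IsLoxodromic b g δ τ) (q q' : G) (n : ℕ) (hn2 : 2 ≤ n)
    (hn : n ≤ (axisProj b g q - axisProj b g q').natAbs) :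
    logDist b q (g ^ axisProj b g q) + n * τ +
      logDist b q' (g ^ axisProj b g q') - 3 * τ ≤ logDist b q q' := by
  linarith [h.le_logDist q q' (by omega), h.two_mul_tau_le hn]

theorem logDist_le_of_axisDist_le (h : IsLoxodromic b g δ τ) {q q' : G} 
    (hq : axisDist b g q ≤ axisDist b g q') :
    logDist b q (g ^ axisProj b g q) ≤ logDist b q' (g ^ axisProj b g q') := by
  unfold logDist
  apply Real.log_le_log (by exact_mod_cast h.one_le _)
  exact_mod_cast hq

theorem behrstock (h : IsLoxodromic b g δ τ) (u w : G) (hu : ¬ Flips (g ^ 2) u)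
    (hw : 51 < (axisProj b g u⁻¹ - axisProj b g (u⁻¹ * w)).natAbs) :
    (axisProj b g u - axisProj b g w).natAbs ≤ 51 := by
  by_contra hc
  have hu' : ¬ Flips (g ^ 2) u⁻¹ := fun hf => hu (by simpa using hf.inv)
  have e1 := h.natAbs_proj_inv_le u hu (axisProj b g (u⁻¹ * w))
  have e2 := h.natAbs_proj_inv_le u⁻¹ hu' (axisProj b g w)
  have b1 := h.le_add_logDist w (u * g ^ axisProj b g (u⁻¹ * w)) 4 (by norm_num) (by omega)
  have b2 := h.le_add_logDist (u⁻¹ * w) (u⁻¹ * g ^ axisProj b g w) 4 (by norm_num) (by omega)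
  rw [logDist_mul_left, logDist_inv_mul] at b2
  have : ∀ x y, 0 ≤ logDist b x y := fun _ _ => Real.log_natCast_nonneg _
  have t1 := this (u * g ^ axisProj b g (u⁻¹ * w))
    (g ^ axisProj b g (u * g ^ axisProj b g (u⁻¹ * w)))
  have t2 := this (u⁻¹ * g ^ axisProj b g w)
    (g ^ axisProj b g (u⁻¹ * g ^ axisProj b g w))
  have hδ := h.pos
  have hτ := h.le
  push_cast at b1 b2
  linarith

theorem proj_closer (h : IsLoxodromic b g δ τ) (u q : G) (hu : ¬ Flips (g ^ 2) u)
    (hq : axisDist b g (u⁻¹ * q) ≤ axisDist b g q) :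
    (axisProj b g q - axisProj b g u).natAbs ≤ 51 := by
  by_contra hc
  have e1 := h.natAbs_proj_inv_le u hu (axisProj b g (u⁻¹ * q))
  have b1 := h.le_add_logDist q (u * g ^ axisProj b g (u⁻¹ * q)) 4 (by norm_num) (by omega)
  have b2 := h.logDist_le_of_axisDist_le hq
  rw [logDist_inv_mul] at b2
  have t1 : 0 ≤ logDist b (u * g ^ axisProj b g (u⁻¹ * q))
    (g ^ axisProj b g (u * g ^ axisProj b g (u⁻¹ * q))) := Real.log_natCast_nonneg _
  have hδ := h.pos
  have hτ := h.le
  push_cast at b1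
  linarith

theorem proj_comparison (h : IsLoxodromic b g δ τ) (u q q' : G) (hu : ¬ Flips (g ^ 2) u)
    (h1 : axisDist b g (u⁻¹ * q) ≤ axisDist b g (u⁻¹ * q'))
    (h2 : axisDist b g q' ≤ axisDist b g q) :
    (axisProj b g q - axisProj b g u).natAbs ≤ (axisProj b g q' - axisProj b g u).natAbs + 51 := by
  by_contra hc
  obtain ⟨y, hy⟩ : ∃ y, y = u * g ^ axisProj b g (u⁻¹ * q) := ⟨_, rfl⟩
  have e1 := h.natAbs_proj_inv_le u hu (axisProj b g (u⁻¹ * q))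
  rw [← hy] at e1
  have b1 := h.le_add_logDist q y ((axisProj b g q' - axisProj b g y).natAbs + 6) (by omega)
    (by omega)
  have b2 := h.logDist_le_of_axisDist_le h1
  have b3 := h.logDist_proj_le (u⁻¹ * q') (axisProj b g (u⁻¹ * q))
  rw [logDist_inv_mul, ← hy] at b2
  rw [logDist_inv_mul b u q' (g ^ axisProj b g (u⁻¹ * q)), ← hy] at b3
  have b4 := h.triangle q' (g ^ axisProj b g y) y
  have b5 := h.logDist_axis_le q' (axisProj b g q') (axisProj b g y)
  have b6 := h.logDist_le_of_axisDist_le h2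
  rw [h.symm (g ^ axisProj b g y) y] at b4
  rw [abs_sub_comm] at b5
  have b7 : (((axisProj b g q' - axisProj b g y).natAbs : ℕ) : ℝ) =
      |((axisProj b g q' : ℝ) - axisProj b g y)| := by
    rw [Nat.cast_natAbs]; push_cast; rfl
  push_cast [b7] at b1
  have hδ := h.pos
  have hτ := h.le
  linarith

/-- Nontrivial elements of the normal closure of a large power are long. -/
theorem lt_log_of_mem_normalClosure (h : IsLoxodromic b g δ τ) (f : G)
    (hf : f ∈ Subgroup.normalClosure {(g ^ 2) ^ 5100}) (h1 : f ≠ 1) :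
    τ ≤ Real.log (b f) := by
  have hδ := h.pos
  have hτ := h.le
  obtain ⟨z, hz⟩ := exists_far_projection (g ^ 2) 5100 (axisProj b g) (axisDist b g) 51
    (by norm_num)
    (fun m q => by
      rw [← zpow_natCast g 2, ← zpow_mul]; exact axisDist_zpow_mul b g q _)
    (fun m q hm => by
      rw [← zpow_natCast g 2, ← zpow_mul]
      have := h.natAbs_proj_zpow_mul q ((2 : ℕ) * ((5100 : ℕ) * m))
      push_cast at *
      omega)
    (fun a c w hac hw => by
      have := h.behrstock (a⁻¹ * c) (a⁻¹ * w) hac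
      simp only [mul_inv_rev, inv_inv, mul_assoc, mul_inv_cancel_left] at this
      exact this hw)
    (fun a c q hac hq => by
      apply h.proj_closer _ _ hac
      simpa only [mul_inv_rev, inv_inv, mul_assoc, mul_inv_cancel_left] using hq)
    (fun a c q q' hac h1 h2 => by
      apply h.proj_comparison _ _ _ hac _ h2
      simpa only [mul_inv_rev, inv_inv, mul_assoc, mul_inv_cancel_left] using h1)
    f (by rwa [← zpow_natCast (g ^ 2)] at hf) h1
  have := h.le_add_logDist z⁻¹ (z⁻¹ * f) 4 (by norm_num) (by omega)
  have t1 : 0 ≤ logDist b z⁻¹ (g ^ axisProj b g z⁻¹) := Real.log_natCast_nonneg _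
  have t2 : 0 ≤ logDist b (z⁻¹ * f) (g ^ axisProj b g (z⁻¹ * f)) := Real.log_natCast_nonneg _
  have t3 : logDist b z⁻¹ (z⁻¹ * f) = Real.log (b f) := by unfold logDist; congr 3; group
  rw [t3] at this
  push_cast at this
  linarith

end IsLoxodromic
end Loxodromic

section Bivariate

open Polynomial
open scoped Polynomial.Bivariate

set_option linter.unusedSectionVars false

section Height

variable (k : Type u) [Field k] {K : Type u} [Field K] [Algebra k[X][Y] K]
  [IsFractionRing k[X][Y] K]

/-- The degree in the outer variable of a bivariate rational function. -/
def height (θ : K) : ℕ :=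
  max (IsFractionRing.num k[X][Y] θ).natDegree (IsFractionRing.den k[X][Y] θ : k[X][Y]).natDegree

theorem exists_reduced (θ : K) : ∃ n d : k[X][Y], d ≠ 0 ∧ IsRelPrime n d ∧
    θ * algebraMap k[X][Y] K d = algebraMap k[X][Y] K n ∧
    height k θ = max n.natDegree d.natDegree := by
  refine ⟨IsFractionRing.num k[X][Y] θ, IsFractionRing.den k[X][Y] θ,
    nonZeroDivisors.coe_ne_zero _, IsFractionRing.num_den_reduced _ _, ?_, rfl⟩
  have h := IsFractionRing.mk'_num_den' k[X][Y] θ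
  rwa [div_eq_iff (by simp), eq_comm] at h

variable {k}

theorem height_le {θ : K} {n d : k[X][Y]} (hd : d ≠ 0)
    (h : θ * algebraMap k[X][Y] K d = algebraMap k[X][Y] K n) :
    height k θ ≤ max n.natDegree d.natDegree := by
  obtain ⟨n', d', hd', hrel, h', hh⟩ := exists_reduced k θ
  have e : n' * d = n * d' := by
    apply IsFractionRing.injective k[X][Y] K
    rw [map_mul, map_mul, ← h, ← h']; ring
  have : d' ∣ d := hrel.symm.dvd_of_dvd_mul_left ⟨n, by rw [e]; ring⟩
  obtain ⟨c, rfl⟩ := this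
  have hn : n = n' * c := by
    apply mul_right_cancel₀ hd'
    rw [← e]; ring
  have hc : c ≠ 0 := right_ne_zero_of_mul hd
  rw [hh, hn]
  apply max_le_max
  · by_cases h0 : n' = 0
    · simp [h0]
    · rw [natDegree_mul h0 hc]; omega
  · rw [natDegree_mul hd' hc]; omega

theorem le_height {θ : K} {n d : k[X][Y]} (hd : d ≠ 0) (hr : IsRelPrime n d)
    (h : θ * algebraMap k[X][Y] K d = algebraMap k[X][Y] K n) :
    max n.natDegree d.natDegree ≤ height k θ := by
  obtain ⟨n', d', hd', hrel, h', hh⟩ := exists_reduced k θ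
  have e : n' * d = n * d' := by
    apply IsFractionRing.injective k[X][Y] K
    rw [map_mul, map_mul, ← h, ← h']; ring
  have : d ∣ d' := hr.symm.dvd_of_dvd_mul_left ⟨n', by rw [← e]; ring⟩
  obtain ⟨c, rfl⟩ := this
  have hn : n' = n * c := by
    apply mul_right_cancel₀ hd
    rw [e]; ring
  have hc : c ≠ 0 := right_ne_zero_of_mul hd'
  rw [hh, hn]
  apply max_le_max
  · by_cases h0 : n = 0
    · simp [h0]
    · rw [natDegree_mul h0 hc]; omega
  · rw [natDegree_mul hd hc]; omega

theorem height_algebraMap (P : k[X][Y]) : height k (algebraMap k[X][Y] K P) = P.natDegree := by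
  have h : algebraMap k[X][Y] K P * algebraMap k[X][Y] K 1 = algebraMap k[X][Y] K P := by simp
  have := height_le one_ne_zero h
  have := le_height one_ne_zero isRelPrime_one_right h
  simp at *
  omega

theorem coeff_swap (P : k[X][Y]) (i j : ℕ) :
    ((Bivariate.swap P).coeff i).coeff j = (P.coeff j).coeff i := by
  induction P using Polynomial.induction_on' with
  | add p q hp hq => simp [hp, hq]
  | monomial n f =>
    induction f using Polynomial.induction_on' with
    | add p q hp hq => simp [hp, hq]
    | monomial m a =>
      rw [Bivariate.swap_monomial_monomial]
      simp only [coeff_monomial]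
      split_ifs <;> simp_all [coeff_monomial]

theorem natDegree_swap_le_iff (P : k[X][Y]) (e : ℕ) :
    (Bivariate.swap P).natDegree ≤ e ↔ ∀ i, (P.coeff i).natDegree ≤ e := by
  simp_rw [natDegree_le_iff_coeff_eq_zero, Polynomial.ext_iff, coeff_swap]
  simp only [coeff_zero]
  exact ⟨fun h i N hN => h N hN i, fun h N hN i => h i N hN⟩

end Height

section Swap

variable (k : Type u) [Field k] (K : Type u) [Field K] [Algebra k[X][Y] K]
  [IsFractionRing k[X][Y] K] [Algebra k K] [IsScalarTower k k[X][Y] K]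

/-- The automorphism of `k(x, y)` induced by an automorphism of `k[x, y]`. -/
def polyAut (e : k[X][Y] ≃ₐ[k] k[X][Y]) : K ≃ₐ[k] K := IsFractionRing.algEquivOfAlgEquiv e

/-- The involution exchanging the two variables. -/
def swapAut : K ≃ₐ[k] K := polyAut k K Bivariate.swap

/-- The inner variable. -/
def xx : K := algebraMap k[X][Y] K (C X)

/-- The outer variable. -/
def yy : K := algebraMap k[X][Y] K X

variable {k K}

theorem polyAut_algebraMap (e : k[X][Y] ≃ₐ[k] k[X][Y]) (P : k[X][Y]) :
    polyAut k K e (algebraMap k[X][Y] K P) = algebraMap k[X][Y] K (e P) :=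
  IsFractionRing.algEquivOfAlgEquiv_algebraMap e P

theorem swapAut_algebraMap (P : k[X][Y]) :
    swapAut k K (algebraMap k[X][Y] K P) = algebraMap k[X][Y] K (Bivariate.swap P) :=
  polyAut_algebraMap _ P

theorem algHom_ext_frac {f g : K ≃ₐ[k] K} (hx : f (xx k K) = g (xx k K))
    (hy : f (yy k K) = g (yy k K)) : f = g := by
  have h : ∀ P : k[X][Y], f (algebraMap k[X][Y] K P) = g (algebraMap k[X][Y] K P) := by
    intro P
    induction P using Polynomial.induction_on' with
    | add p q hp hq => simp [hp, hq]
    | monomial n p =>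
      induction p using Polynomial.induction_on' with
      | add p q hp hq => simp [hp, hq]
      | monomial m a =>
        have : (monomial n (monomial m a) : k[X][Y]) = algebraMap k _ a * C X ^ m * X ^ n := by
          rw [← C_mul_X_pow_eq_monomial, ← C_mul_X_pow_eq_monomial]; simp [mul_assoc]
        rw [this]
        simp only [map_mul, map_pow, ← IsScalarTower.algebraMap_apply, AlgEquiv.commutes]
        change _ * f (xx k K) ^ m * f (yy k K) ^ n = _ * g (xx k K) ^ m * g (yy k K) ^ n
        rw [hx, hy]
  ext θ
  obtain ⟨n, d, hd, -, h', -⟩ := exists_reduced k θ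
  have hd0 : algebraMap k[X][Y] K d ≠ 0 := by simpa using hd
  have : θ = algebraMap k[X][Y] K n / algebraMap k[X][Y] K d := by
    rw [← h']; field_simp
  rw [this, map_div₀, map_div₀, h, h]

@[simp] theorem swapAut_xx : swapAut k K (xx k K) = yy k K := by
  rw [xx, yy, swapAut_algebraMap, Bivariate.swap_X]

@[simp] theorem swapAut_yy : swapAut k K (yy k K) = xx k K := by
  rw [xx, yy, swapAut_algebraMap, Bivariate.swap_Y]

@[simp] theorem swapAut_mul_self : swapAut k K * swapAut k K = 1 :=
  algHom_ext_frac (by simp [AlgEquiv.mul_apply]) (by simp [AlgEquiv.mul_apply])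

@[simp] theorem swapAut_swapAut (θ : K) : swapAut k K (swapAut k K θ) = θ := by
  rw [← AlgEquiv.mul_apply, swapAut_mul_self]; rfl

@[simp] theorem swapAut_inv : (swapAut k K)⁻¹ = swapAut k K :=
  inv_eq_of_mul_eq_one_right swapAut_mul_self

theorem isRelPrime_equiv {A : Type*} [CommRing A] (e : A ≃+* A) {a b : A} (h : IsRelPrime a b) :
    IsRelPrime (e a) (e b) := by
  intro d hda hdb
  have h1 : e.symm d ∣ a := by simpa using map_dvd e.symm hda
  have h2 : e.symm d ∣ b := by simpa using map_dvd e.symm hdb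
  have := (h h1 h2).map e
  simpa using this

/-- A reduced fraction whose bidegrees are controlled by the heights. -/
theorem exists_reduced_swap (θ : K) : ∃ n d : k[X][Y], d ≠ 0 ∧ IsRelPrime n d ∧
    θ * algebraMap k[X][Y] K d = algebraMap k[X][Y] K n ∧
    height k θ = max n.natDegree d.natDegree ∧
    height k (swapAut k K θ) =
      max (Bivariate.swap n).natDegree (Bivariate.swap d).natDegree := by
  obtain ⟨n, d, hd, hr, h, hh⟩ := exists_reduced k θ
  refine ⟨n, d, hd, hr, h, hh, ?_⟩
  have hd' : Bivariate.swap d ≠ 0 := by simpa using hd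
  have hr' : IsRelPrime (Bivariate.swap n) (Bivariate.swap d) :=
    isRelPrime_equiv (Bivariate.swap (R := k)).toRingEquiv hr
  have h' : swapAut k K θ * algebraMap k[X][Y] K (Bivariate.swap d) =
      algebraMap k[X][Y] K (Bivariate.swap n) := by
    rw [← swapAut_algebraMap, ← swapAut_algebraMap, ← h, map_mul]
  exact le_antisymm (height_le hd' h') (le_height hd' hr' h')

end Swap

section Degree

variable {k : Type u} [Field k] {K : Type u} [Field K] [Algebra k[X][Y] K]
  [IsFractionRing k[X][Y] K] [Algebra k K] [IsScalarTower k k[X][Y] K]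

theorem eq_sum_of_natDegree_le (P : k[X][Y]) {e₀ e₁ : ℕ} (h₁ : P.natDegree ≤ e₁)
    (h₀ : (Bivariate.swap P).natDegree ≤ e₀) :
    P = ∑ i ∈ Finset.range (e₁ + 1), ∑ j ∈ Finset.range (e₀ + 1),
      algebraMap k k[X][Y] ((P.coeff i).coeff j) * (C X) ^ j * X ^ i := by
  conv_lhs => rw [P.as_sum_range' (e₁ + 1) (by omega)]
  refine Finset.sum_congr rfl fun i _ => ?_
  have : (P.coeff i).natDegree < e₀ + 1 := by
    have := (natDegree_swap_le_iff P e₀).1 h₀ i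
    omega
  conv_lhs => rw [(P.coeff i).as_sum_range' (e₀ + 1) this]
  rw [map_sum]
  refine Finset.sum_congr rfl fun j _ => ?_
  rw [← C_mul_X_pow_eq_monomial, ← C_mul_X_pow_eq_monomial]
  simp

/-- Clearing denominators after substituting fractions for the two variables. -/
theorem exists_subst (φ : K →ₐ[k] K) (P : k[X][Y]) {e₀ e₁ h₀ h₁ : ℕ} (he₁ : P.natDegree ≤ e₁)
    (he₀ : (Bivariate.swap P).natDegree ≤ e₀) {N₀ D₀ N₁ D₁ : k[X][Y]}
    (hx : φ (xx k K) * algebraMap k[X][Y] K D₀ = algebraMap k[X][Y] K N₀)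
    (hy : φ (yy k K) * algebraMap k[X][Y] K D₁ = algebraMap k[X][Y] K N₁)
    (hN₀ : N₀.natDegree ≤ h₀) (hD₀ : D₀.natDegree ≤ h₀)
    (hN₁ : N₁.natDegree ≤ h₁) (hD₁ : D₁.natDegree ≤ h₁) :
    ∃ Q : k[X][Y], φ (algebraMap k[X][Y] K P) * algebraMap k[X][Y] K (D₀ ^ e₀ * D₁ ^ e₁) =
      algebraMap k[X][Y] K Q ∧ Q.natDegree ≤ e₀ * h₀ + e₁ * h₁ := by
  refine ⟨∑ i ∈ Finset.range (e₁ + 1), ∑ j ∈ Finset.range (e₀ + 1),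
      algebraMap k k[X][Y] ((P.coeff i).coeff j) * (N₀ ^ j * D₀ ^ (e₀ - j)) *
        (N₁ ^ i * D₁ ^ (e₁ - i)), ?_, ?_⟩
  · conv_lhs => rw [eq_sum_of_natDegree_le P he₁ he₀]
    simp only [map_sum, map_mul, map_pow, Finset.sum_mul]
    refine Finset.sum_congr rfl fun i hi => Finset.sum_congr rfl fun j hj => ?_
    simp only [← IsScalarTower.algebraMap_apply, AlgHom.commutes]
    rw [Finset.mem_range] at hi hj
    have e1 : algebraMap k[X][Y] K D₁ ^ e₁ =
        algebraMap k[X][Y] K D₁ ^ i * algebraMap k[X][Y] K D₁ ^ (e₁ - i) := by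
      rw [← pow_add]; congr 1; omega
    have e0 : algebraMap k[X][Y] K D₀ ^ e₀ =
        algebraMap k[X][Y] K D₀ ^ j * algebraMap k[X][Y] K D₀ ^ (e₀ - j) := by
      rw [← pow_add]; congr 1; omega
    rw [← hx, ← hy, e1, e0]
    simp only [xx, yy, mul_pow]
    ring
  · refine natDegree_sum_le_of_forall_le _ _ fun i hi =>
      natDegree_sum_le_of_forall_le _ _ fun j hj => ?_
    rw [Finset.mem_range] at hi hj
    have hp : ∀ {A B : k[X][Y]} {h e j : ℕ}, A.natDegree ≤ h → B.natDegree ≤ h → j < e + 1 →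
        (A ^ j * B ^ (e - j)).natDegree ≤ e * h := by
      intro A B h e j hA hB hj
      refine natDegree_mul_le.trans ?_
      have h1 : (A ^ j).natDegree ≤ j * h := natDegree_pow_le_of_le j hA
      have h2 : (B ^ (e - j)).natDegree ≤ (e - j) * h := natDegree_pow_le_of_le (e - j) hB
      calc _ ≤ j * h + (e - j) * h := add_le_add h1 h2
        _ = e * h := by rw [← add_mul]; congr 1; omega
    have h0 := hp hN₀ hD₀ hj
    have h1 := hp hN₁ hD₁ hi
    refine natDegree_mul_le.trans (add_le_add (natDegree_mul_le.trans ?_) h1)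
    have : (algebraMap k k[X][Y] ((P.coeff i).coeff j)).natDegree = 0 := natDegree_C _
    omega

theorem height_map_le (φ : K ≃ₐ[k] K) (θ : K) :
    height k (φ θ) ≤ height k (swapAut k K θ) * height k (φ (xx k K)) +
      height k θ * height k (φ (yy k K)) := by
  obtain ⟨n, d, hd, -, h, hh, hh'⟩ := exists_reduced_swap (k := k) θ
  obtain ⟨N₀, D₀, hD₀, -, e₀, H₀⟩ := exists_reduced k (φ (xx k K))
  obtain ⟨N₁, D₁, hD₁, -, e₁, H₁⟩ := exists_reduced k (φ (yy k K))
  have hs : ∀ P : k[X][Y], P.natDegree ≤ height k θ →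
    (Bivariate.swap P).natDegree ≤ height k (swapAut k K θ) → _ :=
    fun P h1 h2 => exists_subst φ.toAlgHom P h1 h2 e₀ e₁ (H₀ ▸ le_max_left _ _)
      (H₀ ▸ le_max_right _ _) (H₁ ▸ le_max_left _ _) (H₁ ▸ le_max_right _ _)
  obtain ⟨Qn, hn, hn'⟩ := hs n (hh ▸ le_max_left _ _) (hh' ▸ le_max_left _ _)
  obtain ⟨Qd, hd₁, hd'⟩ := hs d (hh ▸ le_max_right _ _) (hh' ▸ le_max_right _ _)
  have hne : algebraMap k[X][Y] K (D₀ ^ height k (swapAut k K θ) * D₁ ^ height k θ) ≠ 0 := by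
    simp [hD₀, hD₁]
  have hQd : Qd ≠ 0 := by
    rintro rfl
    rw [map_zero, mul_eq_zero] at hd₁
    rcases hd₁ with h' | h'
    · simp [hd] at h'
    · exact hne h'
  refine (height_le (θ := φ θ) hQd (n := Qn) ?_).trans (max_le hn' hd')
  rw [← hd₁, ← hn, ← h, ← mul_assoc]
  simp

variable (k) in
/-- The sum of the heights of the images of the two variables. -/
def rdeg (φ : K ≃ₐ[k] K) : ℕ := height k (φ (xx k K)) + height k (φ (yy k K))

/-- A submultiplicative degree function on the Cremona group. -/
def bdeg (φ : K ≃ₐ[k] K) : ℕ := rdeg k φ + rdeg k (swapAut k K * φ)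

theorem bdeg_mul_le (φ ψ : K ≃ₐ[k] K) : bdeg (φ * ψ) ≤ bdeg φ * bdeg ψ := by
  have h : ∀ χ : K ≃ₐ[k] K, rdeg k (χ * ψ) ≤
      rdeg k (swapAut k K * ψ) * height k (χ (xx k K)) + rdeg k ψ * height k (χ (yy k K)) := by
    intro χ
    have h1 := height_map_le χ (ψ (xx k K))
    have h2 := height_map_le χ (ψ (yy k K))
    simp only [rdeg, AlgEquiv.mul_apply]
    nlinarith
  have h1 := h φ
  have h2 := h (swapAut k K * φ)
  rw [mul_assoc] at h2
  unfold bdeg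
  refine (add_le_add h1 h2).trans ?_
  simp only [rdeg, AlgEquiv.mul_apply]
  nlinarith

theorem bdeg_swap_mul (φ : K ≃ₐ[k] K) : bdeg (swapAut k K * φ) = bdeg φ := by
  simp [bdeg, ← mul_assoc, add_comm]

theorem rdeg_mul_swap (φ : K ≃ₐ[k] K) : rdeg k (φ * swapAut k K) = rdeg k φ := by
  simp [rdeg, AlgEquiv.mul_apply, add_comm]

theorem bdeg_mul_swap (φ : K ≃ₐ[k] K) : bdeg (φ * swapAut k K) = bdeg φ := by
  simp [bdeg, ← mul_assoc, rdeg_mul_swap]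

variable (k K) in
@[simp] theorem height_xx : height k (xx k K) = 0 := by
  rw [xx, height_algebraMap, natDegree_C]

variable (k K) in
@[simp] theorem height_yy : height k (yy k K) = 1 := by
  rw [yy, height_algebraMap, natDegree_X]

variable (k K) in
theorem bdeg_one : bdeg (1 : K ≃ₐ[k] K) = 2 := by
  simp [bdeg, rdeg]

theorem one_le_bdeg (φ : K ≃ₐ[k] K) : 1 ≤ bdeg φ := by
  have := bdeg_mul_le φ φ⁻¹
  rw [mul_inv_cancel, bdeg_one] at this
  by_contra h
  have : bdeg φ = 0 := by omega
  simp_all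

end Degree

section Homog

variable {k : Type u} [Field k] {A : Type u} [CommRing A] [Algebra k A]

/-- Evaluation of the degree `r` homogenization of a polynomial. -/
def homogEval (w : k[X]) (r : ℕ) (u v : A) : A := MvPolynomial.aeval ![u, v] (w.homogenize r)

theorem homogEval_eq_sum (w : k[X]) (r : ℕ) (u v : A) :
    homogEval w r u v =
      ∑ i ∈ Finset.range (r + 1), algebraMap k A (w.coeff i) * (u ^ i * v ^ (r - i)) := by
  unfold homogEval homogenize
  rw [map_sum, Finset.Nat.sum_antidiagonal_eq_sum_range_succ_mk]
  refine Finset.sum_congr rfl fun i _ => ?_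
  rw [MvPolynomial.aeval_monomial, Finsupp.prod_fintype _ _ (by simp)]
  simp

theorem homogEval_mul {p q : k[X]} {m n : ℕ} (hp : p.natDegree ≤ m) (hq : q.natDegree ≤ n)
    (u v : A) : homogEval (p * q) (m + n) u v = homogEval p m u v * homogEval q n u v := by
  simp [homogEval, homogenize_mul p q hp hq]

theorem homogEval_add (p q : k[X]) (n : ℕ) (u v : A) :
    homogEval (p + q) n u v = homogEval p n u v + homogEval q n u v := by
  simp [homogEval]

theorem homogEval_one (n : ℕ) (u v : A) : homogEval (1 : k[X]) n u v = v ^ n := by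
  simp [homogEval]

theorem homogEval_pow {p : k[X]} {m : ℕ} (hp : p.natDegree ≤ m) (j : ℕ) (u v : A) :
    homogEval (p ^ j) (j * m) u v = homogEval p m u v ^ j := by
  induction j with
  | zero => simp [homogEval_one]
  | succ j ih =>
    rw [pow_succ, pow_succ, add_mul, one_mul, homogEval_mul (natDegree_pow_le_of_le j hp) hp, ih]

theorem dvd_homogEval_sub_of_monic {w : k[X]} (hw : w.Monic) (u v : A) :
    v ∣ homogEval w w.natDegree u v - u ^ w.natDegree := by
  rw [homogEval_eq_sum, Finset.sum_range_succ]
  simp only [coeff_natDegree, hw.leadingCoeff, map_one, one_mul, tsub_self, pow_zero, mul_one,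
    add_sub_cancel_right]
  refine Finset.dvd_sum fun i hi => ?_
  rw [Finset.mem_range] at hi
  refine Dvd.dvd.mul_left (Dvd.dvd.mul_left (dvd_pow_self v (by omega)) _) _

theorem exists_dvd_pow_of_isCoprime {p q : k[X]} (h : IsCoprime p q) (u v : A) :
    ∃ M, ∀ c : A, c ∣ homogEval p p.natDegree u v → c ∣ homogEval q q.natDegree u v →
      c ∣ v ^ M := by
  obtain ⟨a, b, hab⟩ := h
  set n := max a.natDegree b.natDegree
  set m := max p.natDegree q.natDegree
  refine ⟨n + p.natDegree + q.natDegree, fun c hp hq => ?_⟩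
  rw [← homogEval_one (k := k), ← hab, homogEval_add]
  refine dvd_add ?_ ?_
  · rw [add_right_comm, homogEval_mul _ le_rfl]
    · exact hp.mul_left _
    · have := le_max_left a.natDegree b.natDegree
      omega
  · rw [homogEval_mul _ le_rfl]
    · exact hq.mul_left _
    · have := le_max_right a.natDegree b.natDegree
      omega

theorem isRelPrime_homogEval [IsDomain A] [UniqueFactorizationMonoid A] {p q : k[X]}
    (h : IsCoprime p q) (hp : p.Monic) {u v : A} (hv : v ≠ 0) (huv : IsRelPrime u v) :
    IsRelPrime (homogEval p p.natDegree u v) (homogEval q q.natDegree u v) := by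
  obtain ⟨M, hM⟩ := exists_dvd_pow_of_isCoprime h u v
  intro c h1 h2
  have h3 := hM c h1 h2
  have hc0 : c ≠ 0 := by rintro rfl; exact pow_ne_zero M hv (zero_dvd_iff.1 h3)
  by_contra hc
  obtain ⟨π, hπ, hπc⟩ := WfDvdMonoid.exists_irreducible_factor hc hc0
  have hπp : Prime π := hπ.prime
  have h4 : π ∣ v := hπp.dvd_of_dvd_pow (hπc.trans h3)
  have h5 : π ∣ u ^ p.natDegree :=
    (dvd_sub_right (hπc.trans h1)).1 (h4.trans (dvd_homogEval_sub_of_monic hp u v))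
  exact hπ.not_isUnit (huv (hπp.dvd_of_dvd_pow h5) h4)

theorem homogEval_ne_zero [IsDomain A] {p q : k[X]}
    (h : IsCoprime p q) (hp : p.Monic) {u v : A} (huv : u ≠ 0 ∨ v ≠ 0) :
    homogEval p p.natDegree u v ≠ 0 ∨ homogEval q q.natDegree u v ≠ 0 := by
  by_contra! hc
  obtain ⟨M, hM⟩ := exists_dvd_pow_of_isCoprime h u v
  have hv : v = 0 :=
    eq_zero_of_pow_eq_zero (zero_dvd_iff.1 (hM 0 (by rw [hc.1]) (by rw [hc.2])))
  have h5 := dvd_homogEval_sub_of_monic hp u v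
  rw [hc.1, zero_sub, dvd_neg, hv, zero_dvd_iff] at h5
  exact huv.elim (fun h => h (eq_zero_of_pow_eq_zero h5)) (fun h => h hv)

theorem finite_not_isRelPrime [IsDomain A] [UniqueFactorizationMonoid A] (h : ℕ → A)
    (hh : ∀ i j, i ≠ j → IsRelPrime (h i) (h j)) {S : A} (hS : S ≠ 0) :
    {i | ¬ IsRelPrime (h i) S}.Finite := by
  induction S using UniqueFactorizationMonoid.induction_on_prime with
  | h₁ => exact absurd rfl hS
  | h₂ x hx =>
    convert Set.finite_empty
    ext i
    simpa using hx.isRelPrime_right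
  | h₃ S p hS' hp ih =>
    refine ((ih hS').union (Set.Subsingleton.finite (s := {i | p ∣ h i}) ?_)).subset ?_
    · intro i hi j hj
      by_contra hij
      exact hp.not_isUnit (hh i j hij hi hj)
    · intro i hi
      by_contra hc
      simp only [Set.mem_union, Set.mem_ofPred_eq, not_or, not_not] at hc hi
      refine hi (IsRelPrime.mul_right ?_ hc.1)
      exact ((hp.irreducible.isRelPrime_iff_not_dvd).2 hc.2).symm

/-- A recursively defined sequence whose successors are pairwise coprime. -/
def euclidSeq (k : Type u) [Field k] : ℕ → k[X]
  | 0 => X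
  | n + 1 => euclidSeq k n * (euclidSeq k n + 1)

theorem euclidSeq_monic (n : ℕ) :
    (euclidSeq k n).Monic ∧ 0 < (euclidSeq k n).natDegree ∧ (euclidSeq k n + 1).Monic ∧
      0 < (euclidSeq k n + 1).natDegree := by
  have key : ∀ p : k[X], p.Monic → 0 < p.natDegree → (p + 1).Monic ∧ 0 < (p + 1).natDegree := by
    intro p hp hd
    refine ⟨hp.add_of_left ?_, ?_⟩
    · rw [degree_one]; exact natDegree_pos_iff_degree_pos.1 hd
    · rw [← C_1, natDegree_add_C]; exact hd
  have : (euclidSeq k n).Monic ∧ 0 < (euclidSeq k n).natDegree := by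
    induction n with
    | zero => exact ⟨monic_X, by simp [euclidSeq]⟩
    | succ n ih =>
      obtain ⟨h1, h2⟩ := key _ ih.1 ih.2
      exact ⟨ih.1.mul h1, by rw [euclidSeq, ih.1.natDegree_mul h1]; omega⟩
  exact ⟨this.1, this.2, key _ this.1 this.2⟩

theorem euclidSeq_isCoprime {i j : ℕ} (hij : i ≠ j) :
    IsCoprime (euclidSeq k i + 1) (euclidSeq k j + 1) := by
  have key : ∀ i j : ℕ, i < j → IsCoprime (euclidSeq k i + 1) (euclidSeq k j + 1) := by
    intro i j hij
    have : euclidSeq k i + 1 ∣ euclidSeq k j := by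
      induction j, hij using Nat.le_induction with
      | base => exact Dvd.intro_left _ rfl
      | succ j _ ih => exact ih.mul_right _
    obtain ⟨c, hc⟩ := this
    exact ⟨-c, 1, by rw [hc]; ring⟩
  rcases lt_or_gt_of_ne hij with h | h
  · exact key _ _ h
  · exact (key _ _ h).symm

end Homog

section Choice

variable {k : Type u} [Field k]

theorem natDegree_homogEval_le (w : k[X]) (r e : ℕ) {U V : k[X][Y]} (hU : U.natDegree ≤ e)
    (hV : V.natDegree ≤ e) : (homogEval w r U V).natDegree ≤ r * e ∧
      (homogEval w r U V).coeff (r * e) = homogEval w r (U.coeff e) (V.coeff e) := by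
  have h : ∀ i ∈ Finset.range (r + 1), (U ^ i * V ^ (r - i)).natDegree ≤ r * e ∧
      (U ^ i * V ^ (r - i)).coeff (r * e) = U.coeff e ^ i * V.coeff e ^ (r - i) := by
    intro i hi
    rw [Finset.mem_range] at hi
    have h1 : (U ^ i).natDegree ≤ i * e := natDegree_pow_le_of_le i hU
    have h2 : (V ^ (r - i)).natDegree ≤ (r - i) * e := natDegree_pow_le_of_le _ hV
    have h3 : r * e = i * e + (r - i) * e := by rw [← add_mul]; congr 1; omega
    rw [h3]
    refine ⟨natDegree_mul_le.trans (add_le_add h1 h2), ?_⟩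
    rw [coeff_mul_add_eq_of_natDegree_le h1 h2, coeff_pow_of_natDegree_le hU,
      coeff_pow_of_natDegree_le hV]
  rw [homogEval_eq_sum, homogEval_eq_sum]
  constructor
  · refine natDegree_sum_le_of_forall_le _ _ fun i hi => ?_
    exact (natDegree_C_mul_le _ _).trans (h i hi).1
  · rw [finsetSum_coeff]
    refine Finset.sum_congr rfl fun i hi => ?_
    rw [← (h i hi).2]
    exact coeff_C_mul _

/-- A generic polynomial whose homogenization at `(U, V)` has full degree and avoids the prime
factors of `S`. -/
theorem exists_generic {U V S : k[X][Y]} (hV : V ≠ 0) (hUV : IsRelPrime U V) (hS : S ≠ 0) :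
    ∃ w : k[X], w.Monic ∧ 0 < w.natDegree ∧ IsRelPrime (homogEval w w.natDegree U V) S ∧
      (homogEval w w.natDegree U V).natDegree =
        w.natDegree * max U.natDegree V.natDegree := by
  set e := max U.natDegree V.natDegree with he
  set W : ℕ → k[X] := fun i => euclidSeq k i + 1
  have hW := fun i => (euclidSeq_monic (k := k) i).2.2
  have f1 := finite_not_isRelPrime (fun i => homogEval (W i) (W i).natDegree U V)
    (fun i j hij => isRelPrime_homogEval (euclidSeq_isCoprime hij) (hW i).1 hV hUV) hS
  have huv : U.coeff e ≠ 0 ∨ V.coeff e ≠ 0 := by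
    rcases le_total U.natDegree V.natDegree with h | h
    · right
      rw [he, max_eq_right h]
      simpa using hV
    · by_cases hU : U = 0
      · right
        rw [he, hU]
        simpa using hV
      · left
        rw [he, max_eq_left h]
        simpa using hU
  have f2 : {i | homogEval (W i) (W i).natDegree (U.coeff e) (V.coeff e) = 0}.Finite := by
    refine Set.Subsingleton.finite fun i hi j hj => ?_
    by_contra hij
    rcases homogEval_ne_zero (euclidSeq_isCoprime (k := k) hij) (hW i).1 huv with h | h
    · exact h hi
    · exact h hj
  obtain ⟨i, hi⟩ := (f1.union f2).exists_notMem
  simp only [Set.mem_union, Set.mem_ofPred_eq, not_or, not_not] at hi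
  refine ⟨W i, (hW i).1, (hW i).2, hi.1, ?_⟩
  obtain ⟨h1, h2⟩ := natDegree_homogEval_le (W i) (W i).natDegree e (le_max_left _ _ : U.natDegree ≤ e)
    (le_max_right _ _)
  refine le_antisymm h1 (le_natDegree_of_ne_zero ?_)
  rw [h2]
  exact hi.2

end Choice

section Independence

variable {k : Type u} [Field k] {K : Type u} [Field K] [Algebra k[X][Y] K]
  [IsFractionRing k[X][Y] K] [Algebra k K] [IsScalarTower k k[X][Y] K]

theorem eq_zero_of_aeval_eq_zero {θ : K} (n : ℕ) : ∀ S : k[X][Y][X], S.natDegree ≤ n →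
    aeval θ S = 0 → (∀ j, (S.coeff j).natDegree < height k θ) → S = 0 := by
  induction n with
  | zero =>
    intro S hS h0 hj
    rw [eq_C_of_natDegree_le_zero hS] at h0 ⊢
    rw [aeval_C, FaithfulSMul.algebraMap_eq_zero_iff] at h0
    rw [h0, map_zero]
  | succ n ih =>
    intro S hS h0 hj
    by_contra hne
    have hd : (IsFractionRing.den k[X][Y] θ : k[X][Y]).natDegree < height k θ :=
      (natDegree_le_of_dvd (den_dvd_of_is_root h0) (by simpa using hne)).trans_lt (hj _)
    have hn : height k θ = (IsFractionRing.num k[X][Y] θ).natDegree := by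
      unfold height at hd ⊢
      omega
    have hc : S.coeff 0 = 0 := by
      by_contra hc
      have := (natDegree_le_of_dvd (num_dvd_of_is_root h0) hc).trans_lt (hj _)
      omega
    have hθ : θ ≠ 0 := by
      rintro rfl
      simp at hn
      omega
    have hX := S.divX_mul_X_add
    rw [hc, map_zero, add_zero] at hX
    rw [← hX] at hne
    apply hne
    rw [ih S.divX ?_ ?_ ?_, zero_mul]
    · rw [natDegree_divX_eq_natDegree_tsub_one]; omega
    · rw [← hX, map_mul, aeval_X] at h0
      exact (mul_eq_zero.1 h0).resolve_right hθ
    · intro j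
      rw [coeff_divX]
      exact hj _

theorem linearIndependent_height (θ : K) :
    LinearIndependent k (fun t : ℕ × Fin (height k θ) × ℕ =>
      xx k K ^ t.1 * yy k K ^ (t.2.1 : ℕ) * θ ^ t.2.2) := by
  rw [linearIndependent_iff]
  intro c hc
  set S : k[X][Y][X] := c.sum fun t a => monomial t.2.2 (monomial (t.2.1 : ℕ) (monomial t.1 a))
    with hS
  have hcoeff : ∀ j, S.coeff j = c.sum fun t a =>
      if t.2.2 = j then monomial (t.2.1 : ℕ) (monomial t.1 a) else 0 := by
    intro j
    simp only [hS, Finsupp.sum, finsetSum_coeff, coeff_monomial]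
  have hS0 : S = 0 := by
    by_cases hh : height k θ = 0
    · have : IsEmpty (ℕ × Fin (height k θ) × ℕ) := by
        rw [hh]; infer_instance
      rw [hS, Subsingleton.elim c 0, Finsupp.sum_zero_index]
    refine eq_zero_of_aeval_eq_zero (θ := θ) _ S le_rfl ?_ ?_
    · rw [← hc, hS, Finsupp.linearCombination_apply, Finsupp.sum, Finsupp.sum, map_sum]
      refine Finset.sum_congr rfl fun t _ => ?_
      rw [aeval_monomial, Algebra.smul_def, ← mul_assoc, ← mul_assoc]
      congr 1
      rw [← C_mul_X_pow_eq_monomial, ← C_mul_X_pow_eq_monomial]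
      simp only [map_mul, map_pow, xx, yy]
      rw [IsScalarTower.algebraMap_apply k k[X][Y] K]
      rfl
    · intro j
      rw [hcoeff]
      refine lt_of_le_of_lt (natDegree_sum_le_of_forall_le _ _ (n := height k θ - 1) fun t _ => ?_)
        (by omega)
      dsimp only
      split_ifs
      · refine (natDegree_monomial_le _).trans ?_
        have := t.2.1.2
        omega
      · simp
  ext ⟨i, l, j⟩
  have h1 : ((S.coeff j).coeff l).coeff i = c (i, l, j) := by
    rw [hcoeff, Finsupp.sum, finsetSum_coeff, finsetSum_coeff, Finset.sum_eq_single (i, l, j)]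
    · simp
    · rintro ⟨i', l', j'⟩ _ hne
      dsimp only
      split_ifs with h1
      · rw [coeff_monomial]
        split_ifs with h2
        · rw [coeff_monomial, if_neg]
          rintro rfl
          apply hne
          rw [h1, Fin.ext h2]
        · simp
      · simp
    · intro h
      simp [Finsupp.notMem_support_iff.1 h]
  rw [← h1, hS0]
  simp

end Independence

section Siegel

variable {k : Type u} [Field k]

theorem exists_dvd_combination {I : Type} [Fintype I] (F : I → k[X][Y]) {m : ℕ}
    (hF : ∀ t, (F t).natDegree ≤ m) {W : k[X]} (hW : W.Monic)
    (hcard : (m + 1) * W.natDegree < Fintype.card I) :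
    ∃ c : I → k, c ≠ 0 ∧ C W ∣ ∑ t, c t • F t := by
  let pb := AdjoinRoot.powerBasis' hW
  have : Module.Finite k (AdjoinRoot W) := pb.finite
  let L : (I → k) →ₗ[k] (Fin (m + 1) → AdjoinRoot W) :=
    LinearMap.pi fun i => (AdjoinRoot.mkₐ W).toLinearMap.restrictScalars k ∘ₗ
      ((Polynomial.lcoeff k[X] (i : ℕ)).restrictScalars k) ∘ₗ Fintype.linearCombination k F
  have hL : LinearMap.ker L ≠ ⊥ := by
    apply LinearMap.ker_ne_bot_of_finrank_lt
    rw [Module.finrank_pi_fintype, Module.finrank_fintype_fun_eq_card]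
    simpa [pb.finrank, pb] using hcard
  obtain ⟨c, hc, hc0⟩ := Submodule.exists_mem_ne_zero_of_ne_bot hL
  refine ⟨c, hc0, (C_dvd_iff_dvd_coeff _ _).2 fun i => ?_⟩
  by_cases hi : i < m + 1
  · have := congr_fun (LinearMap.mem_ker.1 hc) ⟨i, hi⟩
    exact AdjoinRoot.mk_eq_zero.1 this
  · rw [coeff_eq_zero_of_natDegree_lt]
    · exact dvd_zero _
    · refine lt_of_le_of_lt (natDegree_sum_le_of_forall_le _ _ (n := m) fun t _ => ?_) (by omega)
      exact (natDegree_smul_le _ _).trans (hF t)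

end Siegel

section Core

variable {k : Type u} [Field k] {K : Type u} [Field K] [Algebra k[X][Y] K]
  [IsFractionRing k[X][Y] K] [Algebra k K] [IsScalarTower k k[X][Y] K]

theorem exists_clear (c₀ c₁ d : K) : ∃ d₀ d₁ d₂ : k[X][Y], d₀ ≠ 0 ∧ d₁ ≠ 0 ∧ d₂ ≠ 0 ∧
    ∀ p q i l j, i ≤ p → l ≤ p → j ≤ q → ∃ F : k[X][Y],
      F.natDegree ≤ p * (height k c₀ + height k c₁) + q * height k d ∧
      c₀ ^ i * c₁ ^ l * d ^ j * algebraMap k[X][Y] K (d₀ ^ p * d₁ ^ p * d₂ ^ q) =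
        algebraMap k[X][Y] K F := by
  have key : ∀ θ : K, ∃ D : k[X][Y], D ≠ 0 ∧ ∀ p i, i ≤ p → ∃ F : k[X][Y],
      F.natDegree ≤ p * height k θ ∧ θ ^ i * algebraMap k[X][Y] K (D ^ p) =
        algebraMap k[X][Y] K F := by
    intro θ
    obtain ⟨n, D, hD, -, h, hh⟩ := exists_reduced k θ
    refine ⟨D, hD, fun p i hi => ⟨n ^ i * D ^ (p - i), ?_, ?_⟩⟩
    · have h1 : (n ^ i).natDegree ≤ i * height k θ :=
        natDegree_pow_le_of_le i (hh ▸ le_max_left _ _)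
      have h2 : (D ^ (p - i)).natDegree ≤ (p - i) * height k θ :=
        natDegree_pow_le_of_le _ (hh ▸ le_max_right _ _)
      calc _ ≤ _ := natDegree_mul_le.trans (add_le_add h1 h2)
        _ = p * height k θ := by rw [← add_mul]; congr 1; omega
    · obtain ⟨m, rfl⟩ := Nat.exists_eq_add_of_le hi
      simp only [map_mul, map_pow, ← h, Nat.add_sub_cancel_left]
      ring
  obtain ⟨d₀, h₀, H₀⟩ := key c₀
  obtain ⟨d₁, h₁, H₁⟩ := key c₁
  obtain ⟨d₂, h₂, H₂⟩ := key d
  refine ⟨d₀, d₁, d₂, h₀, h₁, h₂, fun p q i l j hi hl hj => ?_⟩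
  obtain ⟨F₀, a₀, b₀⟩ := H₀ p i hi
  obtain ⟨F₁, a₁, b₁⟩ := H₁ p l hl
  obtain ⟨F₂, a₂, b₂⟩ := H₂ q j hj
  refine ⟨F₀ * F₁ * F₂, ?_, ?_⟩
  · have := (natDegree_mul_le (p := F₀ * F₁) (q := F₂))
    have := (natDegree_mul_le (p := F₀) (q := F₁))
    rw [mul_add]; omega
  · simp only [map_mul, ← b₀, ← b₁, ← b₂]
    ring

theorem map_homogEval {A B : Type u} [CommRing A] [Algebra k A] [CommRing B] [Algebra k B]
    (f : A →ₐ[k] B) (w : k[X]) (n : ℕ) (u v : A) :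
    f (homogEval w n u v) = homogEval w n (f u) (f v) := by
  simp [homogEval_eq_sum]

theorem aeval_mul_pow {A : Type u} [CommRing A] [Algebra k A] {w : k[X]} {n : ℕ}
    (hw : w.natDegree ≤ n) {θ u v : A} (h : θ * v = u) :
    aeval θ w * v ^ n = homogEval w n u v := by
  rw [homogEval_eq_sum, aeval_eq_sum_range' (n := n + 1) (by omega), Finset.sum_mul]
  refine Finset.sum_congr rfl fun i hi => ?_
  rw [Finset.mem_range] at hi
  obtain ⟨m, rfl⟩ := Nat.exists_eq_add_of_le (Nat.lt_succ_iff.1 hi)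
  rw [← h, Algebra.smul_def, Nat.add_sub_cancel_left]
  ring

theorem algebraMap_smul_frac (c : k) (F : k[X][Y]) :
    algebraMap k[X][Y] K (c • F) = c • algebraMap k[X][Y] K F :=
  map_smul (IsScalarTower.toAlgHom k k[X][Y] K) c F

theorem map_algebraMap_C (φ : K ≃ₐ[k] K) (W : k[X]) :
    φ (algebraMap k[X][Y] K (C W)) = aeval (φ (xx k K)) W := by
  have : algebraMap k[X][Y] K (C W) = aeval (xx k K) W := by
    rw [xx, aeval_algebraMap_apply]
    congr 1
    induction W using Polynomial.induction_on' with
    | add p q hp hq => simp only [map_add, hp, hq]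
    | monomial n a => rw [← C_mul_X_pow_eq_monomial]; simp
  rw [this, ← aeval_algHom_apply]

/-- A Siegel lemma argument bounding the multiplicity of a generic fibre. -/
theorem exists_step (φ : K ≃ₐ[k] K) (c₀ c₁ d : K) (b : ℕ)
    (hind : LinearIndependent k
      (fun t : ℕ × Fin b × ℕ => c₀ ^ t.1 * c₁ ^ (t.2.1 : ℕ) * d ^ t.2.2)) :
    ∃ r, 0 < r ∧ ∀ p q j, b ≤ p + 1 →
      (p * (height k c₀ + height k c₁) + q * height k d + 1) * (j * r) < (p + 1) * b * (q + 1) →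
      j * (r * height k (φ (xx k K))) ≤
        p * (height k (φ c₀) + height k (φ c₁)) + q * height k (φ d) := by
  obtain ⟨d₀, d₁, d₂, hd₀, hd₁, hd₂, hF⟩ := exists_clear (k := k) c₀ c₁ d
  obtain ⟨d₀', d₁', d₂', hd₀', hd₁', hd₂', hF'⟩ := exists_clear (k := k) (φ c₀) (φ c₁) (φ d)
  obtain ⟨U, V, hV, hUV, hx, hH⟩ := exists_reduced k (φ (xx k K))
  obtain ⟨U', V', hV', -, hy, -⟩ := exists_reduced k (φ (yy k K))
  have clear : ∀ P : k[X][Y], ∃ (A B : ℕ) (f : k[X][Y]), φ (algebraMap k[X][Y] K P) *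
      algebraMap k[X][Y] K (V ^ A * V' ^ B) = algebraMap k[X][Y] K f ∧ (P ≠ 0 → f ≠ 0) := by
    intro P
    obtain ⟨f, hf, -⟩ := exists_subst φ.toAlgHom P le_rfl le_rfl hx hy (le_max_left _ _)
      (le_max_right _ _) (le_max_left _ _) (le_max_right _ _)
    refine ⟨_, _, f, hf, ?_⟩
    rintro hP rfl
    rw [map_zero, mul_eq_zero] at hf
    rcases hf with hf | hf
    · simp [hP] at hf
    · simp [hV, hV'] at hf
  obtain ⟨A₀, B₀, f₀, hf₀, hf₀'⟩ := clear d₀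
  obtain ⟨A₁, B₁, f₁, hf₁, hf₁'⟩ := clear d₁
  obtain ⟨A₂, B₂, f₂, hf₂, hf₂'⟩ := clear d₂
  obtain ⟨w, hw, hw0, hrel, hdeg⟩ := exists_generic (S := f₀ * f₁ * f₂ * V * V') hV hUV
    (by simp [hf₀' hd₀, hf₁' hd₁, hf₂' hd₂, hV, hV'])
  refine ⟨w.natDegree, hw0, fun p q j hb hcount => ?_⟩
  choose F hFd hFe using fun t : Fin (p + 1) × Fin b × Fin (q + 1) =>
    hF p q t.1 t.2.1 t.2.2 (by omega) (by omega) (by omega)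
  choose F' hFd' hFe' using fun t : Fin (p + 1) × Fin b × Fin (q + 1) =>
    hF' p q t.1 t.2.1 t.2.2 (by omega) (by omega) (by omega)
  obtain ⟨c, hc, ψ, hψ⟩ := exists_dvd_combination F hFd (hw.pow j) (by
    rw [hw.natDegree_pow]
    simpa [mul_assoc] using hcount)
  set v : Fin (p + 1) × Fin b × Fin (q + 1) → K := fun t =>
    c₀ ^ (t.1 : ℕ) * c₁ ^ (t.2.1 : ℕ) * d ^ (t.2.2 : ℕ) with hv
  set z : K := ∑ t, c t • v t with hz
  have hz0 : z ≠ 0 := by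
    have hinj : Function.Injective (fun t : Fin (p + 1) × Fin b × Fin (q + 1) =>
        (((t.1 : ℕ), t.2.1, (t.2.2 : ℕ)) : ℕ × Fin b × ℕ)) := by
      rintro ⟨i, l, j⟩ ⟨i', l', j'⟩ h
      simp only [Prod.mk.injEq] at h
      rw [Fin.ext h.1, h.2.1, Fin.ext h.2.2]
    have := Fintype.linearIndependent_iff.1 (hind.comp _ hinj) c
    intro h0
    exact hc (funext (this h0))
  have e1 : z * algebraMap k[X][Y] K (d₀ ^ p * d₁ ^ p * d₂ ^ q) =
      algebraMap k[X][Y] K (C (w ^ j)) * algebraMap k[X][Y] K ψ := by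
    rw [← map_mul, ← hψ, map_sum, hz, Finset.sum_mul]
    refine Finset.sum_congr rfl fun t _ => ?_
    rw [smul_mul_assoc, hFe, algebraMap_smul_frac]
  set Q : k[X][Y] := ∑ t, c t • F' t with hQ
  have e2 : φ z * algebraMap k[X][Y] K (d₀' ^ p * d₁' ^ p * d₂' ^ q) =
      algebraMap k[X][Y] K Q := by
    rw [hQ, hz, map_sum, map_sum, Finset.sum_mul]
    refine Finset.sum_congr rfl fun t _ => ?_
    rw [map_smul, smul_mul_assoc, algebraMap_smul_frac, ← hFe']
    simp [hv]
  have hQ0 : Q ≠ 0 := by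
    intro h0
    rw [h0, map_zero, mul_eq_zero] at e2
    rcases e2 with h | h
    · simp [hz0] at h
    · simp [hd₀', hd₁', hd₂'] at h
  have hQd : Q.natDegree ≤
      p * (height k (φ c₀) + height k (φ c₁)) + q * height k (φ d) :=
    natDegree_sum_le_of_forall_le _ _ fun t _ => (natDegree_smul_le _ _).trans (hFd' t)
  have e3 : φ (algebraMap k[X][Y] K (C (w ^ j))) * algebraMap k[X][Y] K (V ^ (j * w.natDegree)) =
      algebraMap k[X][Y] K (homogEval w w.natDegree U V ^ j) := by
    rw [map_algebraMap_C, map_pow (algebraMap k[X][Y] K) V,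
      aeval_mul_pow (natDegree_pow_le_of_le j le_rfl) hx, homogEval_pow le_rfl, map_pow]
    congr 1
    exact (map_homogEval (IsScalarTower.toAlgHom k k[X][Y] K) _ _ _ _).symm
  obtain ⟨A, B, g, hg, -⟩ := clear ψ
  have hdvd : homogEval w w.natDegree U V ^ j ∣
      Q * (f₀ ^ p * f₁ ^ p * f₂ ^ q * V ^ (j * w.natDegree) * (V ^ A * V' ^ B)) := by
    refine ⟨g * (d₀' ^ p * d₁' ^ p * d₂' ^ q) *
      ((V ^ A₀ * V' ^ B₀) ^ p * (V ^ A₁ * V' ^ B₁) ^ p * (V ^ A₂ * V' ^ B₂) ^ q), ?_⟩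
    apply IsFractionRing.injective k[X][Y] K
    have e1' := congr_arg φ e1
    simp only [map_mul, map_pow] at e1' e2 e3 hg hf₀ hf₁ hf₂ ⊢
    rw [← e2, ← e3, ← hg, ← hf₀, ← hf₁, ← hf₂]
    simp only [mul_pow]
    linear_combination ((algebraMap k[X][Y] K d₀') ^ p * (algebraMap k[X][Y] K d₁') ^ p *
      (algebraMap k[X][Y] K d₂') ^ q * ((algebraMap k[X][Y] K V ^ A₀) ^ p *
      (algebraMap k[X][Y] K V' ^ B₀) ^ p * (algebraMap k[X][Y] K V ^ A₁) ^ p *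
      (algebraMap k[X][Y] K V' ^ B₁) ^ p * (algebraMap k[X][Y] K V ^ A₂) ^ q *
      (algebraMap k[X][Y] K V' ^ B₂) ^ q) * algebraMap k[X][Y] K V ^ (j * w.natDegree) *
      (algebraMap k[X][Y] K V ^ A * algebraMap k[X][Y] K V' ^ B)) * e1'
  have r1 := hrel.of_mul_right_right
  have r2 := hrel.of_mul_right_left.of_mul_right_right
  have r3 := hrel.of_mul_right_left.of_mul_right_left
  have hdvd' : homogEval w w.natDegree U V ^ j ∣ Q := by
    refine IsRelPrime.dvd_of_dvd_mul_right ?_ hdvd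
    exact ((((r3.of_mul_right_left.of_mul_right_left.pow.mul_right
      r3.of_mul_right_left.of_mul_right_right.pow).mul_right
      r3.of_mul_right_right.pow).mul_right r2.pow).mul_right (r2.pow.mul_right r1.pow))
  have := natDegree_le_of_dvd hdvd' hQ0
  rw [natDegree_pow, hdeg, ← hH] at this
  exact this.trans hQd

end Core

theorem le_of_counting {s t b e a a' r : ℕ} (hr : 0 < r)
    (h : ∀ M j : ℕ, b ≤ s * M + 1 →
      (M * a + 1) * (j * r) < (s * M + 1) * b * (t * M + 1) → j * (r * e) ≤ M * a') :
    s * t * b * e ≤ a * a' := by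
  by_contra! hlt
  have hs : 0 < s := Nat.pos_of_ne_zero (by rintro rfl; simp at hlt)
  have hb : 0 < b := Nat.pos_of_ne_zero (by rintro rfl; simp at hlt)
  set M := b + (a' + r * e * a + r * e + 1) with hM
  have hbM : b ≤ s * M + 1 := by
    have : M ≤ s * M := Nat.le_mul_of_pos_left _ hs
    omega
  set X := (s * M + 1) * b * (t * M + 1) with hX
  set Z := (M * a + 1) * r with hZ
  have hX0 : 0 < X := by positivity
  have hZ0 : 0 < Z := by positivity
  set j := (X - 1) / Z with hj
  have h1 : Z * j ≤ X - 1 := Nat.mul_div_le _ _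
  have h2 : X - 1 < Z * (j + 1) := Nat.lt_mul_div_succ _ hZ0
  have h3 := h M j hbM (by
    calc (M * a + 1) * (j * r) = Z * j := by rw [hZ]; ring
      _ < X := by omega)
  have h4 : X ≤ Z * (j + 1) := by omega
  have h5 : M * M * (s * t * b) ≤ X := by
    calc M * M * (s * t * b) = (s * M) * b * (t * M) := by ring
      _ ≤ X := by rw [hX]; gcongr <;> omega
  have h6 : M * M * (s * t * b * e) ≤ (M * a + 1) * (M * a' + r * e) := by
    calc M * M * (s * t * b * e) = M * M * (s * t * b) * e := by ring
      _ ≤ Z * (j + 1) * e := Nat.mul_le_mul_right _ (h5.trans h4)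
      _ = (M * a + 1) * (j * (r * e) + r * e) := by rw [hZ]; ring
      _ ≤ _ := by gcongr
  have h7 : M * M * (a * a' + 1) ≤ M * M * (s * t * b * e) := Nat.mul_le_mul_left _ hlt
  have h8 : M * (a' + r * e * a) + r * e < M * M := by
    have : M * (a' + r * e * a + r * e + 1) ≤ M * M := Nat.mul_le_mul_left _ (by omega)
    have hM1 : 1 ≤ M := by omega
    nlinarith [Nat.zero_le (r * e)]
  nlinarith

section FourPoint

variable {k : Type u} [Field k] {K : Type u} [Field K] [Algebra k[X][Y] K]
  [IsFractionRing k[X][Y] K] [Algebra k K] [IsScalarTower k k[X][Y] K]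

theorem height_mul_height_le (C D φ : K ≃ₐ[k] K) (s t : ℕ) :
    s * t * height k ((C⁻¹ * D) (yy k K)) * height k (φ (xx k K)) ≤
      (s * rdeg k C + t * height k (D (yy k K))) *
        (s * rdeg k (φ * C) + t * height k ((φ * D) (yy k K))) := by
  have hind := (linearIndependent_height (k := k) ((C⁻¹ * D) (yy k K))).map'
    C.toLinearMap (LinearMap.ker_eq_bot.2 C.injective)
  have hfun : (fun t : ℕ × Fin (height k ((C⁻¹ * D) (yy k K))) × ℕ =>
      C (xx k K) ^ t.1 * C (yy k K) ^ (t.2.1 : ℕ) * D (yy k K) ^ t.2.2) = C.toLinearMap ∘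
      fun t => xx k K ^ t.1 * yy k K ^ (t.2.1 : ℕ) * ((C⁻¹ * D) (yy k K)) ^ t.2.2 := by
    have : C ((C⁻¹ * D) (yy k K)) = D (yy k K) := by
      rw [← AlgEquiv.mul_apply, mul_inv_cancel_left]
    funext t
    rw [Function.comp_apply, AlgEquiv.toLinearMap_apply, map_mul, map_mul, map_pow, map_pow,
      map_pow, this]
  rw [← hfun] at hind
  obtain ⟨r, hr, h⟩ := exists_step φ (C (xx k K)) (C (yy k K)) (D (yy k K))
    (height k ((C⁻¹ * D) (yy k K))) hind
  refine le_of_counting hr fun M j hb hc => ?_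
  have := h (s * M) (t * M) j hb (by
    refine lt_of_eq_of_lt ?_ hc
    simp only [rdeg]
    ring)
  refine this.trans (le_of_eq ?_)
  simp only [rdeg, AlgEquiv.mul_apply]
  ring

theorem rdeg_le_bdeg (φ : K ≃ₐ[k] K) : rdeg k φ ≤ bdeg φ := Nat.le_add_right _ _

theorem height_yy_le_bdeg (φ : K ≃ₐ[k] K) : height k (φ (yy k K)) ≤ bdeg φ :=
  (Nat.le_add_left _ _).trans (rdeg_le_bdeg φ)

theorem bdeg_eq (C D : K ≃ₐ[k] K) : bdeg (C⁻¹ * D) =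
    height k ((C⁻¹ * D) (yy k K)) + height k ((C⁻¹ * (D * swapAut k K)) (yy k K)) +
    height k (((C * swapAut k K)⁻¹ * D) (yy k K)) +
    height k (((C * swapAut k K)⁻¹ * (D * swapAut k K)) (yy k K)) := by
  simp only [bdeg, rdeg, mul_inv_rev, swapAut_inv, AlgEquiv.mul_apply, swapAut_yy]
  ring

theorem bdeg_eq' (C D : K ≃ₐ[k] K) : bdeg (C⁻¹ * D) =
    height k ((C⁻¹ * D) (xx k K)) + height k ((C⁻¹ * (D * swapAut k K)) (xx k K)) +
    height k (((C * swapAut k K)⁻¹ * D) (xx k K)) +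
    height k (((C * swapAut k K)⁻¹ * (D * swapAut k K)) (xx k K)) := by
  simp only [bdeg, rdeg, mul_inv_rev, swapAut_inv, AlgEquiv.mul_apply, swapAut_xx]
  ring

theorem bdeg_inv_mul_swap (C D : K ≃ₐ[k] K) : bdeg (C⁻¹ * (D * swapAut k K)) = bdeg (C⁻¹ * D) := by
  rw [← mul_assoc, bdeg_mul_swap]

theorem bdeg_mul_swap_inv (C D : K ≃ₐ[k] K) :
    bdeg ((C * swapAut k K)⁻¹ * D) = bdeg (C⁻¹ * D) := by
  rw [mul_inv_rev, mul_assoc, swapAut_inv, bdeg_swap_mul]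

theorem bdeg_four_point_aux (A B C D : K ≃ₐ[k] K) (s t : ℕ) :
    s * t * bdeg (C⁻¹ * D) * bdeg (B⁻¹ * A) ≤
      16 * ((s * bdeg (A⁻¹ * C) + t * bdeg (A⁻¹ * D)) *
        (s * bdeg (B⁻¹ * C) + t * bdeg (B⁻¹ * D))) := by
  have h1 : ∀ A B C D : K ≃ₐ[k] K,
      s * t * height k ((C⁻¹ * D) (yy k K)) * height k ((B⁻¹ * A) (xx k K)) ≤
      (s * bdeg (A⁻¹ * C) + t * bdeg (A⁻¹ * D)) *
        (s * bdeg (B⁻¹ * C) + t * bdeg (B⁻¹ * D)) := by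
    intro A B C D
    have := height_mul_height_le (A⁻¹ * C) (A⁻¹ * D) (B⁻¹ * A) s t
    simp only [mul_inv_rev, inv_inv, mul_assoc, mul_inv_cancel_left] at this
    refine le_trans (le_of_eq ?_) (this.trans ?_)
    · ring
    · gcongr
      exacts [rdeg_le_bdeg _, height_yy_le_bdeg _, rdeg_le_bdeg _, height_yy_le_bdeg _]
  have h2 : ∀ C D : K ≃ₐ[k] K,
      s * t * height k ((C⁻¹ * D) (yy k K)) * bdeg (B⁻¹ * A) ≤
      4 * ((s * bdeg (A⁻¹ * C) + t * bdeg (A⁻¹ * D)) *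
        (s * bdeg (B⁻¹ * C) + t * bdeg (B⁻¹ * D))) := by
    intro C D
    have e1 := h1 A B C D
    have e2 := h1 (A * swapAut k K) B C D
    have e3 := h1 A (B * swapAut k K) C D
    have e4 := h1 (A * swapAut k K) (B * swapAut k K) C D
    simp only [bdeg_mul_swap_inv] at e2 e3 e4
    rw [bdeg_eq', mul_add, mul_add, mul_add]
    omega
  have e1 := h2 C D
  have e2 := h2 (C * swapAut k K) D
  have e3 := h2 C (D * swapAut k K)
  have e4 := h2 (C * swapAut k K) (D * swapAut k K)
  simp only [bdeg_inv_mul_swap] at e2 e3 e4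
  rw [bdeg_eq C D, mul_add, mul_add, mul_add, add_mul, add_mul, add_mul]
  omega

theorem bdeg_four_point (A B C D : K ≃ₐ[k] K) :
    bdeg (C⁻¹ * D) * bdeg (B⁻¹ * A) ≤
      32 * (bdeg (A⁻¹ * D) * bdeg (B⁻¹ * C) + bdeg (A⁻¹ * C) * bdeg (B⁻¹ * D)) := by
  have h := bdeg_four_point_aux A B C D (bdeg (A⁻¹ * D)) (bdeg (A⁻¹ * C))
  have h1 := one_le_bdeg (A⁻¹ * D)
  have h2 := one_le_bdeg (A⁻¹ * C)
  have h3 : 0 < bdeg (A⁻¹ * D) * bdeg (A⁻¹ * C) := Nat.mul_pos h1 h2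
  refine Nat.le_of_mul_le_mul_left ?_ h3
  refine le_trans (le_of_eq ?_) (h.trans (le_of_eq ?_)) <;> ring

theorem bdeg_le_inv (φ : K ≃ₐ[k] K) : bdeg φ ≤ 160 * bdeg φ⁻¹ := by
  have h := bdeg_four_point φ 1 1 φ
  simp only [inv_one, one_mul, mul_one, inv_mul_cancel, bdeg_one] at h
  have h1 := one_le_bdeg φ
  have h2 := one_le_bdeg φ⁻¹
  nlinarith

/-- The symmetrized degree. -/
def sdeg (φ : K ≃ₐ[k] K) : ℕ := max (bdeg φ) (bdeg φ⁻¹)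

theorem bdeg_le_sdeg (φ : K ≃ₐ[k] K) : bdeg φ ≤ sdeg φ := le_max_left _ _

theorem sdeg_inv (φ : K ≃ₐ[k] K) : sdeg φ⁻¹ = sdeg φ := by
  simp [sdeg, max_comm]

theorem one_le_sdeg (φ : K ≃ₐ[k] K) : 1 ≤ sdeg φ := (one_le_bdeg φ).trans (bdeg_le_sdeg φ)

theorem sdeg_mul_le (φ ψ : K ≃ₐ[k] K) : sdeg (φ * ψ) ≤ sdeg φ * sdeg ψ := by
  refine max_le ((bdeg_mul_le φ ψ).trans (Nat.mul_le_mul (le_max_left _ _) (le_max_left _ _))) ?_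
  rw [mul_inv_rev]
  refine (bdeg_mul_le _ _).trans ?_
  rw [mul_comm]
  exact Nat.mul_le_mul (le_max_right _ _) (le_max_right _ _)

theorem sdeg_le (φ : K ≃ₐ[k] K) : sdeg φ ≤ 160 * bdeg φ := by
  refine max_le (by omega) ?_
  simpa using bdeg_le_inv φ⁻¹

theorem sdeg_four_point (p q r s : K ≃ₐ[k] K) :
    sdeg (p⁻¹ * q) * sdeg (r⁻¹ * s) ≤ 1638400 *
      max (sdeg (p⁻¹ * r) * sdeg (q⁻¹ * s)) (sdeg (p⁻¹ * s) * sdeg (q⁻¹ * r)) := by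
  have h := bdeg_four_point s r p q
  have h1 : ∀ u v : K ≃ₐ[k] K, bdeg (u⁻¹ * v) ≤ sdeg (v⁻¹ * u) := by
    intro u v
    rw [← sdeg_inv]
    simpa using bdeg_le_sdeg (u⁻¹ * v)
  have h2 := Nat.mul_le_mul (h1 s q) (h1 r p)
  have h3 := Nat.mul_le_mul (h1 s p) (h1 r q)
  have h4 := Nat.mul_le_mul (sdeg_le (p⁻¹ * q)) (sdeg_le (r⁻¹ * s))
  have h5 := le_max_left (sdeg (p⁻¹ * r) * sdeg (q⁻¹ * s)) (sdeg (p⁻¹ * s) * sdeg (q⁻¹ * r))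
  have h6 := le_max_right (sdeg (p⁻¹ * r) * sdeg (q⁻¹ * s)) (sdeg (p⁻¹ * s) * sdeg (q⁻¹ * r))
  nlinarith

theorem logDist_four_point (p q r s : K ≃ₐ[k] K) :
    logDist sdeg p q + logDist sdeg r s ≤
      max (logDist sdeg p r + logDist sdeg q s) (logDist sdeg p s + logDist sdeg q r) +
        Real.log 1638400 := by
  have hpos : ∀ u : K ≃ₐ[k] K, (0 : ℝ) < sdeg u := fun u => by exact_mod_cast one_le_sdeg u
  have h : (sdeg (p⁻¹ * q) * sdeg (r⁻¹ * s) : ℝ) ≤ 1638400 *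
      max (sdeg (p⁻¹ * r) * sdeg (q⁻¹ * s) : ℝ) (sdeg (p⁻¹ * s) * sdeg (q⁻¹ * r)) := by
    exact_mod_cast sdeg_four_point p q r s
  have hl : ∀ u v : K ≃ₐ[k] K, Real.log (sdeg u) + Real.log (sdeg v) =
      Real.log (sdeg u * sdeg v) := fun u v =>
    (Real.log_mul (hpos u).ne' (hpos v).ne').symm
  simp only [logDist, hl]
  rcases max_choice (sdeg (p⁻¹ * r) * sdeg (q⁻¹ * s) : ℝ) (sdeg (p⁻¹ * s) * sdeg (q⁻¹ * r))
    with hm | hm <;> rw [hm] at h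
  · have := Real.log_le_log (mul_pos (hpos _) (hpos _)) h
    rw [Real.log_mul (by norm_num) (mul_pos (hpos _) (hpos _)).ne', add_comm] at this
    exact this.trans (by gcongr; exact le_max_left _ _)
  · have := Real.log_le_log (mul_pos (hpos _) (hpos _)) h
    rw [Real.log_mul (by norm_num) (mul_pos (hpos _) (hpos _)).ne', add_comm] at this
    exact this.trans (by gcongr; exact le_max_right _ _)

end FourPoint

section Henon

variable (k : Type u) [Field k] (N : ℕ)

/-- The substitution `y ↦ x ^ N - y`. -/
def foldHom : k[X][Y] →ₐ[k] k[X][Y] := aevalAeval (C X) (C X ^ N - X)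

theorem foldHom_C (a : k[X]) : foldHom k N (C a) = C a := by
  rw [foldHom, aevalAeval_C]
  induction a using Polynomial.induction_on' with
  | add p q hp hq => simp only [map_add, hp, hq]
  | monomial n a => rw [← C_mul_X_pow_eq_monomial]; simp

theorem foldHom_X : foldHom k N X = C X ^ N - X := aevalAeval_Y _ _

theorem foldHom_foldHom (P : k[X][Y]) : foldHom k N (foldHom k N P) = P := by
  induction P using Polynomial.induction_on' with
  | add p q hp hq => simp only [map_add, hp, hq]
  | monomial n a =>
    rw [← C_mul_X_pow_eq_monomial]
    simp only [map_mul, map_pow, foldHom_C, foldHom_X, map_sub, sub_sub_cancel]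

/-- The involution `y ↦ x ^ N - y`. -/
def foldEquiv : k[X][Y] ≃ₐ[k] k[X][Y] :=
  AlgEquiv.ofAlgHom (foldHom k N) (foldHom k N) (AlgHom.ext (foldHom_foldHom k N))
    (AlgHom.ext (foldHom_foldHom k N))

@[simp] theorem foldEquiv_C (a : k[X]) : foldEquiv k N (C a) = C a := foldHom_C k N a

@[simp] theorem foldEquiv_X : foldEquiv k N X = C X ^ N - X := foldHom_X k N

/-- The polynomial Hénon automorphism `x ↦ y`, `y ↦ y ^ N - x`. -/
def henonEquiv : k[X][Y] ≃ₐ[k] k[X][Y] := (foldEquiv k N).trans Bivariate.swap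

variable {k}

theorem henonEquiv_C (a : k[X]) : henonEquiv k N (C a) = a.map C := by
  simp [henonEquiv, Bivariate.swap_C]

theorem henonEquiv_X : henonEquiv k N X = X ^ N - C X := by
  simp only [henonEquiv, AlgEquiv.trans_apply, foldEquiv_X, map_sub, map_pow, Bivariate.swap_X,
    Bivariate.swap_Y]

variable {N}

theorem natDegree_X_pow_sub (hN : 0 < N) :
    ((X : k[X][Y]) ^ N - C X).natDegree = N ∧ ((X : k[X][Y]) ^ N - C X).Monic :=
  ⟨natDegree_X_pow_sub_C, monic_X_pow_sub_C _ hN.ne'⟩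

theorem natDegree_henonEquiv_term (hN : 0 < N) (a : k[X]) (l : ℕ) :
    (henonEquiv k N (C a * X ^ l)).natDegree ≤ a.natDegree + l * N := by
  rw [map_mul, map_pow, henonEquiv_C, henonEquiv_X]
  refine natDegree_mul_le.trans (add_le_add ?_ ?_)
  · exact natDegree_map_le
  · exact natDegree_pow_le_of_le l (natDegree_X_pow_sub hN).1.le

theorem le_natDegree_henonEquiv (hN : 0 < N) {P : k[X][Y]}
    (hP : (Bivariate.swap P).natDegree < N) :
    N * P.natDegree ≤ (henonEquiv k N P).natDegree := by
  rcases Nat.eq_zero_or_pos P.natDegree with h0 | h0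
  · simp [h0]
  have hc : ∀ i, (P.coeff i).natDegree < N := fun i =>
    ((natDegree_swap_le_iff P _).1 le_rfl i).trans_lt hP
  have h1 : (henonEquiv k N (∑ i ∈ Finset.range P.natDegree, C (P.coeff i) * X ^ i)).natDegree <
      N * P.natDegree := by
    rw [map_sum]
    refine lt_of_le_of_lt (natDegree_sum_le_of_forall_le _ _ (n := N * P.natDegree - 1)
      fun i hi => ?_) (Nat.sub_lt (Nat.mul_pos hN h0) one_pos)
    rw [Finset.mem_range] at hi
    refine (natDegree_henonEquiv_term hN _ _).trans ?_
    have := hc i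
    have : (i + 1) * N ≤ P.natDegree * N := Nat.mul_le_mul_right _ hi
    have : (i + 1) * N = i * N + N := by ring
    rw [mul_comm N]
    omega
  have h2 : (henonEquiv k N (C P.leadingCoeff * X ^ P.natDegree)).natDegree =
      P.leadingCoeff.natDegree + P.natDegree * N := by
    have hP0 : P ≠ 0 := by rintro rfl; simp at h0
    rw [map_mul, map_pow, henonEquiv_C, henonEquiv_X, natDegree_mul, natDegree_pow,
      (natDegree_X_pow_sub hN).1, natDegree_map]
    · simpa [Polynomial.map_eq_zero] using hP0
    · exact pow_ne_zero _ (natDegree_X_pow_sub hN).2.ne_zero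
  conv_rhs => rw [P.as_sum_range_C_mul_X_pow, Finset.sum_range_succ, map_add]
  rw [coeff_natDegree, natDegree_add_eq_right_of_natDegree_lt, h2, mul_comm]
  · exact Nat.le_add_left _ _
  · rw [h2, mul_comm P.natDegree]
    omega

theorem isRelPrime_C_map_C {c q : k[X]} (hc : c ≠ 0) (hq : q ≠ 0) :
    IsRelPrime (C c : k[X][Y]) (q.map C) := by
  intro D h1 h2
  have hD : D.natDegree = 0 := by
    have := natDegree_le_of_dvd h1 (by simpa using hc)
    simpa using this
  rw [natDegree_eq_zero] at hD
  obtain ⟨D₀, rfl⟩ := hD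
  rw [C_dvd_iff_dvd_coeff] at h2
  have h3 := h2 q.natDegree
  rw [coeff_map, coeff_natDegree] at h3
  exact (isUnit_of_dvd_unit h3 ((isUnit_iff_ne_zero.2 (by simpa using hq)).map C)).map C

theorem isRelPrime_C_fold {c q : k[X]} (hc : c ≠ 0) (hq : q ≠ 0) :
    IsRelPrime (C c : k[X][Y]) (foldEquiv k N (q.map C)) := by
  have := isRelPrime_equiv (foldEquiv k N).toRingEquiv (isRelPrime_C_map_C hc hq)
  simpa using this

theorem natDegree_swap_fold (q : k[X]) :
    (Bivariate.swap (foldEquiv k N (q.map C))).natDegree = q.natDegree * N := by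
  have : Bivariate.swap (foldEquiv k N (q.map C)) = (q.map C).comp (X ^ N - C X) := by
    induction q using Polynomial.induction_on' with
    | add p q hp hq => simp only [Polynomial.map_add, map_add, hp, hq, add_comp]
    | monomial n a =>
      rw [map_monomial, ← C_mul_X_pow_eq_monomial, mul_comp, pow_comp, X_comp, C_comp, map_mul,
        map_pow, foldEquiv_X, foldEquiv_C, map_mul, map_pow, map_sub, map_pow, Bivariate.swap_X,
        Bivariate.swap_Y, Bivariate.swap_C_C]
  rw [this, natDegree_comp, natDegree_X_pow_sub_C, natDegree_map]

end Henon

section HenonAut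

variable (k : Type u) [Field k] (K : Type u) [Field K] [Algebra k[X][Y] K]
  [IsFractionRing k[X][Y] K] [Algebra k K] [IsScalarTower k k[X][Y] K] (N : ℕ)

/-- The birational involution `y ↦ x ^ N - y`. -/
def foldAut : K ≃ₐ[k] K := polyAut k K (foldEquiv k N)

/-- The Hénon automorphism of `k(x, y)`. -/
def henon : K ≃ₐ[k] K := swapAut k K * foldAut k K N

variable {k K}

@[simp] theorem foldAut_xx : foldAut k K N (xx k K) = xx k K := by
  rw [foldAut, xx, polyAut_algebraMap, foldEquiv_C]

@[simp] theorem foldAut_yy : foldAut k K N (yy k K) = xx k K ^ N - yy k K := by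
  rw [foldAut, yy, polyAut_algebraMap, foldEquiv_X, map_sub, map_pow, xx]

@[simp] theorem foldAut_mul_self : foldAut k K N * foldAut k K N = 1 :=
  algHom_ext_frac (by simp [AlgEquiv.mul_apply]) (by simp [AlgEquiv.mul_apply])

@[simp] theorem foldAut_inv : (foldAut k K N)⁻¹ = foldAut k K N :=
  inv_eq_of_mul_eq_one_right (foldAut_mul_self N)

@[simp] theorem henon_xx : henon k K N (xx k K) = yy k K := by simp [henon, AlgEquiv.mul_apply]

@[simp] theorem henon_yy : henon k K N (yy k K) = yy k K ^ N - xx k K := by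
  simp [henon, AlgEquiv.mul_apply]

theorem henon_inv : (henon k K N)⁻¹ = foldAut k K N * swapAut k K := by
  simp [henon]

theorem henon_algebraMap (P : k[X][Y]) :
    henon k K N (algebraMap k[X][Y] K P) = algebraMap k[X][Y] K (henonEquiv k N P) := by
  rw [henon, AlgEquiv.mul_apply, foldAut, polyAut_algebraMap, swapAut_algebraMap]
  rfl

theorem swapAut_mul_henon : swapAut k K * henon k K N = (henon k K N)⁻¹ * swapAut k K := by
  rw [henon_inv, mul_assoc, swapAut_mul_self, henon, ← mul_assoc, swapAut_mul_self, one_mul,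
    mul_one]

theorem swapAut_conj_henon_zpow (n : ℤ) :
    swapAut k K * henon k K N ^ n * swapAut k K = henon k K N ^ (-n) := by
  have h : swapAut k K * henon k K N * (swapAut k K)⁻¹ = (henon k K N)⁻¹ := by
    rw [swapAut_mul_henon, mul_inv_cancel_right]
  have := congr_arg (· ^ n) h
  simp only [conj_zpow, inv_zpow'] at this
  rwa [swapAut_inv] at this

/-- The polynomials giving the iterates of the Hénon map. -/
def henonIter (k : Type u) [Field k] (N : ℕ) : ℕ → k[X][Y]
  | 0 => X
  | 1 => X ^ N - C X
  | n + 2 => henonIter k N (n + 1) ^ N - henonIter k N n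

theorem henon_pow_yy (n : ℕ) :
    (henon k K N ^ n) (yy k K) = algebraMap k[X][Y] K (henonIter k N n) ∧
    (henon k K N ^ (n + 1)) (yy k K) = algebraMap k[X][Y] K (henonIter k N (n + 1)) := by
  have hx : ∀ n, (henon k K N ^ (n + 1)) (xx k K) = (henon k K N ^ n) (yy k K) := by
    intro n
    rw [pow_succ, AlgEquiv.mul_apply, henon_xx]
  induction n with
  | zero =>
    constructor
    · rw [pow_zero, henonIter, yy, AlgEquiv.one_apply]
    · rw [zero_add, pow_one, henon_yy, henonIter, map_sub, map_pow, xx, yy]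
  | succ n ih =>
    refine ⟨ih.2, ?_⟩
    rw [pow_succ, AlgEquiv.mul_apply, henon_yy, map_sub, map_pow, hx, ih.1, ih.2, henonIter,
      map_sub, map_pow]

variable {N}

theorem natDegree_henonIter (hN : 2 ≤ N) (n : ℕ) :
    (henonIter k N n).natDegree = N ^ n ∧ (henonIter k N (n + 1)).natDegree = N ^ (n + 1) := by
  induction n with
  | zero => simp [henonIter]
  | succ n ih =>
    refine ⟨ih.2, ?_⟩
    rw [henonIter, natDegree_sub_eq_left_of_natDegree_lt]
    · rw [natDegree_pow, ih.2, ← pow_succ']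
    · rw [natDegree_pow, ih.2, ih.1, ← pow_succ']
      exact Nat.pow_lt_pow_right hN (by omega)

theorem natDegree_swap_henonIter (hN : 2 ≤ N) (n : ℕ) :
    (Bivariate.swap (henonIter k N n)).natDegree ≤ N ^ n ∧
      (Bivariate.swap (henonIter k N (n + 1))).natDegree ≤ N ^ (n + 1) := by
  induction n with
  | zero =>
    constructor
    · rw [henonIter, Bivariate.swap_Y, natDegree_C]; omega
    · rw [henonIter, map_sub, map_pow, Bivariate.swap_Y, Bivariate.swap_X, ← C_pow,
        ← natDegree_neg, neg_sub, natDegree_X_sub_C]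
      rw [zero_add, pow_one]; omega
  | succ n ih =>
    refine ⟨ih.2, ?_⟩
    rw [henonIter, map_sub, map_pow]
    refine (natDegree_sub_le _ _).trans (max_le ?_ ?_)
    · rw [pow_succ' N (n + 1)]
      exact natDegree_pow_le_of_le N ih.2
    · exact ih.1.trans (Nat.pow_le_pow_right (by omega) (by omega))

theorem le_bdeg_henon_pow (hN : 2 ≤ N) (n : ℕ) : N ^ n ≤ bdeg (henon k K N ^ n) := by
  refine le_trans (le_of_eq ?_) (height_yy_le_bdeg _)
  rw [(henon_pow_yy N n).1, height_algebraMap, (natDegree_henonIter hN n).1]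

theorem bdeg_henon_pow_le (hN : 2 ≤ N) (n : ℕ) : bdeg (henon k K N ^ n) ≤ 4 * N ^ n := by
  cases n with
  | zero => simp [bdeg_one]
  | succ n =>
    have hx : (henon k K N ^ (n + 1)) (xx k K) = (henon k K N ^ n) (yy k K) := by
      rw [pow_succ, AlgEquiv.mul_apply, henon_xx]
    simp only [bdeg, rdeg, AlgEquiv.mul_apply, hx]
    rw [(henon_pow_yy N n).1, (henon_pow_yy N n).2, swapAut_algebraMap, swapAut_algebraMap,
      height_algebraMap, height_algebraMap, height_algebraMap, height_algebraMap,
      (natDegree_henonIter hN n).1, (natDegree_henonIter hN n).2]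
    have h1 := natDegree_swap_henonIter (k := k) hN n
    have h2 : N ^ n ≤ N ^ (n + 1) := Nat.pow_le_pow_right (by omega) (by omega)
    omega

theorem sdeg_henon_pow (n : ℕ) : sdeg (henon k K N ^ n) = bdeg (henon k K N ^ n) := by
  have h := swapAut_conj_henon_zpow (k := k) (K := K) N n
  rw [zpow_neg, zpow_natCast] at h
  rw [sdeg, ← h, bdeg_mul_swap, bdeg_swap_mul, max_self]

theorem height_henon (hN : 0 < N) {θ : K} (hθ : height k (swapAut k K θ) < N) :
    N * height k θ ≤ height k (henon k K N θ) := by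
  obtain ⟨n, d, hd, hr, h, hh, hh'⟩ := exists_reduced_swap (k := k) θ
  have h1 := isRelPrime_equiv (henonEquiv k N).toRingEquiv hr
  have h2 : henon k K N θ * algebraMap k[X][Y] K (henonEquiv k N d) =
      algebraMap k[X][Y] K (henonEquiv k N n) := by
    rw [← henon_algebraMap, ← henon_algebraMap, ← h, map_mul]
  refine le_trans ?_ (le_height (by simpa using hd) h1 h2)
  rw [hh, ← Nat.mul_max_mul_left]
  rw [hh', max_lt_iff] at hθ
  exact max_le_max (le_natDegree_henonEquiv hN hθ.1) (le_natDegree_henonEquiv hN hθ.2)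

end HenonAut

section Centralizer

variable {k : Type u} [Field k] {K : Type u} [Field K] [Algebra k[X][Y] K]
  [IsFractionRing k[X][Y] K] [Algebra k K] [IsScalarTower k k[X][Y] K] {N : ℕ}

theorem exists_of_height_eq_zero {θ : K} (h : height k θ = 0) :
    ∃ p q : k[X], q ≠ 0 ∧ IsCoprime p q ∧
      θ * algebraMap k[X][Y] K (C q) = algebraMap k[X][Y] K (C p) := by
  obtain ⟨n, d, hd, hr, e, hh⟩ := exists_reduced k θ
  rw [h, eq_comm, ← Nat.le_zero, max_le_iff, Nat.le_zero, Nat.le_zero, natDegree_eq_zero,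
    natDegree_eq_zero] at hh
  obtain ⟨⟨p, rfl⟩, q, rfl⟩ := hh
  refine ⟨p, q, by simpa using hd, IsRelPrime.isCoprime fun d h1 h2 => ?_, e⟩
  exact isUnit_C.1 (hr (map_dvd C h1) (map_dvd C h2))

theorem natDegree_eq_zero_of_pow_sub {ψ A B : K} {a c p q : k[X]} (hc : c ≠ 0) (hq : q ≠ 0)
    (hac : IsCoprime a c) (hpq : IsCoprime p q)
    (hA : A * algebraMap k[X][Y] K (C c) = algebraMap k[X][Y] K (C a))
    (hB : B * algebraMap k[X][Y] K (foldEquiv k N (q.map C)) =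
      algebraMap k[X][Y] K (foldEquiv k N (p.map C)))
    (hψ : ψ = A ^ N - B) (hN : height k (swapAut k K ψ) < N) :
    q.natDegree = 0 ∧ c.natDegree = 0 := by
  obtain ⟨n, d, hd, hr, e, -, hh⟩ := exists_reduced_swap (k := k) ψ
  set Q := foldEquiv k N (q.map C) with hQ
  set P := foldEquiv k N (p.map C) with hP
  have hPQ : IsRelPrime P Q := by
    have := (hpq.map (mapRingHom C)).map (foldEquiv k N).toRingHom
    exact this.isRelPrime
  have hca : IsRelPrime (C c : k[X][Y]) (C a) := (hac.symm.map C).isRelPrime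
  have hcQ : IsRelPrime (C c) Q := isRelPrime_C_fold hc hq
  have key : n * C c ^ N * Q = d * (C a ^ N * Q - C c ^ N * P) := by
    apply IsFractionRing.injective k[X][Y] K
    simp only [map_mul, map_sub, map_pow]
    rw [← e, ← hA, ← hB, hψ]
    ring
  have hsd : (Bivariate.swap d).natDegree < N := lt_of_le_of_lt (le_max_right _ _) (hh ▸ hN)
  have hsd0 : Bivariate.swap d ≠ 0 := by simpa using hd
  have h1 : Q ∣ d := by
    have : Q ∣ d * (C c ^ N * P) :=
      ⟨d * C a ^ N - n * C c ^ N, by linear_combination key⟩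
    refine (IsRelPrime.mul_right ?_ hPQ.symm).dvd_of_dvd_mul_right this
    exact hcQ.symm.pow_right
  have h2 : C c ^ N ∣ d := by
    have : C c ^ N ∣ d * (C a ^ N * Q) := ⟨n * Q + d * P, by linear_combination -key⟩
    refine (IsRelPrime.mul_right ?_ ?_).dvd_of_dvd_mul_right this
    · exact hca.pow
    · exact hcQ.pow_left
  have h3 := natDegree_le_of_dvd (map_dvd Bivariate.swap h1) hsd0
  have h4 := natDegree_le_of_dvd (map_dvd Bivariate.swap h2) hsd0
  rw [hQ, natDegree_swap_fold] at h3
  rw [map_pow, Bivariate.swap_C, natDegree_pow, natDegree_map] at h4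
  constructor
  · by_contra h
    have := Nat.le_mul_of_pos_left N (Nat.pos_of_ne_zero h)
    omega
  · by_contra h
    have := Nat.le_mul_of_pos_right N (Nat.pos_of_ne_zero h)
    omega

theorem height_le_bdeg (φ : K ≃ₐ[k] K) :
    height k (φ (xx k K)) ≤ bdeg φ ∧ height k (φ (yy k K)) ≤ bdeg φ ∧
      height k (swapAut k K (φ (xx k K))) ≤ bdeg φ ∧
      height k (swapAut k K (φ (yy k K))) ≤ bdeg φ := by
  simp only [bdeg, rdeg, AlgEquiv.mul_apply]
  omega

/-- The degrees of `f` and of its conjugates by the Hénon map and its inverse are less than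
`N - 1`. -/
def IsSmall (N : ℕ) (f : K ≃ₐ[k] K) : Prop :=
  bdeg f + 1 < N ∧ bdeg ((henon k K N)⁻¹ * f * henon k K N) + 1 < N ∧
    bdeg (henon k K N * f * (henon k K N)⁻¹) + 1 < N

theorem swapAut_mul_henon_inv :
    swapAut k K * (henon k K N)⁻¹ = henon k K N * swapAut k K := by
  rw [henon_inv, henon, mul_assoc]

theorem IsSmall.swap {f : K ≃ₐ[k] K} (h : IsSmall N f) :
    IsSmall N (swapAut k K * f * swapAut k K) := by
  obtain ⟨h1, h2, h3⟩ := h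
  refine ⟨by rwa [bdeg_mul_swap, bdeg_swap_mul], ?_, ?_⟩
  · rw [show (henon k K N)⁻¹ * (swapAut k K * f * swapAut k K) * henon k K N =
      swapAut k K * (henon k K N * f * (henon k K N)⁻¹) * swapAut k K by
        simp only [mul_assoc, swapAut_mul_henon]
        simp only [← mul_assoc, swapAut_mul_henon], bdeg_mul_swap, bdeg_swap_mul]
    exact h3
  · rw [show henon k K N * (swapAut k K * f * swapAut k K) * (henon k K N)⁻¹ =
      swapAut k K * ((henon k K N)⁻¹ * f * henon k K N) * swapAut k K by
        simp only [mul_assoc, swapAut_mul_henon_inv]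
        simp only [← mul_assoc, swapAut_mul_henon_inv], bdeg_mul_swap, bdeg_swap_mul]
    exact h2

theorem IsSmall.height_swapAut_yy {f : K ≃ₐ[k] K} (h : IsSmall N f) :
    height k (swapAut k K (f (yy k K))) = 0 := by
  obtain ⟨h1, h2, -⟩ := h
  set f' := (henon k K N)⁻¹ * f * henon k K N with hf'
  have e : henon k K N (f' (xx k K)) = f (yy k K) := by
    rw [← AlgEquiv.mul_apply, hf', mul_assoc, mul_inv_cancel_left, AlgEquiv.mul_apply, henon_xx]
  have hb := height_le_bdeg f
  have hb' := height_le_bdeg f'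
  have h3 := height_henon (by omega) (hb'.2.2.1.trans_lt (by omega : bdeg f' < N))
  rw [e] at h3
  have h4 : height k (f' (xx k K)) = 0 := by
    by_contra h0
    have := Nat.le_mul_of_pos_right N (Nat.pos_of_ne_zero h0)
    omega
  have h5 := height_map_le (foldAut k K N) (f' (xx k K))
  rw [← e, henon, AlgEquiv.mul_apply, swapAut_swapAut, ← Nat.le_zero]
  simpa [h4] using h5

theorem IsSmall.height_xx {f : K ≃ₐ[k] K} (h : IsSmall N f) : height k (f (xx k K)) = 0 := by
  simpa [AlgEquiv.mul_apply] using h.swap.height_swapAut_yy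

theorem conj_henon_yy (f : K ≃ₐ[k] K) :
    ((henon k K N)⁻¹ * f * henon k K N) (yy k K) =
      foldAut k K N (swapAut k K (f (yy k K))) ^ N -
        foldAut k K N (swapAut k K (f (xx k K))) := by
  simp [AlgEquiv.mul_apply, henon_inv]

theorem foldAut_algebraMap (P : k[X][Y]) :
    foldAut k K N (algebraMap k[X][Y] K P) = algebraMap k[X][Y] K (foldEquiv k N P) :=
  polyAut_algebraMap _ _

theorem IsSmall.exists_polynomial {f : K ≃ₐ[k] K} (h : IsSmall N f) :
    ∃ p : k[X], f (xx k K) = algebraMap k[X][Y] K (C p) := by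
  obtain ⟨a, c, hc, hac, e⟩ := exists_of_height_eq_zero h.height_swapAut_yy
  obtain ⟨p, q, hq, hpq, e'⟩ := exists_of_height_eq_zero h.height_xx
  have e1 := congr_arg (foldAut k K N) e
  have e2 := congr_arg (fun θ => foldAut k K N (swapAut k K θ)) e'
  simp only [map_mul, foldAut_algebraMap, swapAut_algebraMap, Bivariate.swap_C,
    foldEquiv_C] at e1 e2
  have h1 := height_le_bdeg ((henon k K N)⁻¹ * f * henon k K N)
  have h2 := h.2.1
  have := (natDegree_eq_zero_of_pow_sub hc hq hac hpq e1 e2 (conj_henon_yy f) (by omega)).1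
  rw [natDegree_eq_zero] at this
  obtain ⟨q, rfl⟩ := this
  have hq0 : q ≠ 0 := by simpa using hq
  refine ⟨C q⁻¹ * p, ?_⟩
  rw [map_mul, map_mul, ← e', mul_comm, mul_assoc, ← map_mul, ← map_mul, ← map_mul,
    mul_inv_cancel₀ hq0]
  simp

theorem aeval_algebraMap_C (p W : k[X]) :
    aeval (algebraMap k[X][Y] K (C p)) W = algebraMap k[X][Y] K (C (W.comp p)) := by
  rw [aeval_algebraMap_apply]
  congr 1
  induction W using Polynomial.induction_on' with
  | add p q hp hq => simp only [map_add, hp, hq, add_comp]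
  | monomial n a =>
    rw [← C_mul_X_pow_eq_monomial]
    simp [Polynomial.algebraMap_apply]

theorem IsSmall.exists_affine {f : K ≃ₐ[k] K} (h : IsSmall N f) (h' : IsSmall N f⁻¹) :
    ∃ b r : k, b ≠ 0 ∧ f (xx k K) = algebraMap k[X][Y] K (C (C b * (X + C r))) := by
  obtain ⟨p, hp⟩ := h.exists_polynomial
  obtain ⟨q, hq⟩ := h'.exists_polynomial
  have h1 : f (f⁻¹ (xx k K)) = xx k K := by
    rw [← AlgEquiv.mul_apply, mul_inv_cancel, AlgEquiv.one_apply]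
  rw [hq, map_algebraMap_C, hp, aeval_algebraMap_C, xx] at h1
  have h2 : q.comp p = X := C_injective (IsFractionRing.injective k[X][Y] K h1)
  have h3 := congr_arg natDegree h2
  rw [natDegree_comp, natDegree_X, mul_eq_one] at h3
  obtain ⟨b, hb, c, rfl⟩ := natDegree_eq_one.1 h3.2
  refine ⟨b, b⁻¹ * c, hb, ?_⟩
  rw [hp, mul_add, ← C_mul, mul_inv_cancel_left₀ hb]

theorem eq_of_natDegree_lt {R : Type*} [CommRing R] [IsDomain R] {a b r t : R} {w : R}
    (hN : (N : R) ≠ 0) (hN1 : 1 < N) (ha : a ≠ 0)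
    (h : ((C a * (X + C r)) ^ N - (C b * (X ^ N + C w) + C t)).natDegree + 1 < N) :
    a ^ N = b ∧ r = 0 := by
  have h1 := coeff_eq_zero_of_natDegree_lt ((Nat.lt_succ_self _).trans h)
  have h2 := coeff_eq_zero_of_natDegree_lt (Nat.lt_sub_of_add_lt h)
  rw [mul_pow, ← C_pow, coeff_sub, coeff_add, coeff_C_mul, coeff_C_mul, coeff_X_add_C_pow,
    coeff_add, coeff_X_pow, coeff_C_of_ne_zero (by omega), coeff_C_of_ne_zero (by omega)] at h1 h2
  constructor
  · simpa [sub_eq_zero] using h1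
  · rw [if_neg (by omega), show N - (N - 1) = 1 by omega, Nat.choose_symm (by omega),
      Nat.choose_one_right] at h2
    simpa [ha, hN] using h2

theorem IsSmall.pow_eq {f : K ≃ₐ[k] K} (h : IsSmall N f) (hN : (N : k) ≠ 0) {a b r t : k}
    (ha : a ≠ 0) (hx : f (xx k K) = algebraMap k[X][Y] K (C (C b * (X + C t))))
    (hy : swapAut k K (f (yy k K)) = algebraMap k[X][Y] K (C (C a * (X + C r)))) :
    a ^ N = b ∧ r = 0 := by
  have h1 := (height_le_bdeg ((henon k K N)⁻¹ * f * henon k K N)).2.2.2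
  have h2 := h.2.1
  rw [conj_henon_yy, hx, hy, swapAut_algebraMap, foldAut_algebraMap, foldAut_algebraMap,
    ← map_pow, ← map_sub, swapAut_algebraMap, height_algebraMap] at h1
  simp only [map_mul, map_add, map_sub, map_pow, Bivariate.swap_X, Bivariate.swap_Y,
    Bivariate.swap_C_C, foldEquiv_C, foldEquiv_X] at h1
  have := eq_of_natDegree_lt (R := k[X]) (N := N) (a := C a) (b := C b) (r := C r)
    (t := C b * C t) (w := - X) (by
      rw [← C_eq_natCast, Ne, C_eq_zero]; exact hN) (by omega) (by simpa using ha) (by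
      refine lt_of_le_of_lt (add_le_add_left (le_of_eq_of_le ?_ h1) 1) h2
      congr 1
      simp only [map_mul, map_neg]
      ring)
  rw [← C_pow] at this
  exact ⟨C_injective this.1, by simpa using this.2⟩

theorem IsSmall.commute {f : K ≃ₐ[k] K} (h : IsSmall N f) (h' : IsSmall N f⁻¹)
    (hN : (N : k) ≠ 0) : Commute (henon k K N ^ 2) f := by
  obtain ⟨b, t, hb, hx⟩ := h.exists_affine h'
  have h's := h'.swap
  rw [show swapAut k K * f⁻¹ * swapAut k K = (swapAut k K * f * swapAut k K)⁻¹ by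
    simp [mul_assoc]] at h's
  obtain ⟨a, r, ha, hy⟩ := h.swap.exists_affine h's
  rw [AlgEquiv.mul_apply, swapAut_xx, AlgEquiv.mul_apply] at hy
  obtain ⟨hab, rfl⟩ := h.pow_eq hN ha hx hy
  obtain ⟨hba, rfl⟩ := h.swap.pow_eq hN hb
    (by rw [AlgEquiv.mul_apply, swapAut_xx, AlgEquiv.mul_apply, hy])
    (by rw [AlgEquiv.mul_apply, swapAut_yy, AlgEquiv.mul_apply, swapAut_swapAut, hx])
  have hC : ∀ c : k, algebraMap k[X][Y] K (C (C c)) = algebraMap k K c := fun c => by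
    rw [IsScalarTower.algebraMap_apply k k[X][Y] K]; rfl
  have hx' : f (xx k K) = algebraMap k K b * xx k K := by
    rw [hx]; simp [hC, xx]
  have hy' : f (yy k K) = algebraMap k K a * yy k K := by
    rw [← swapAut_swapAut (k := k) (f (yy k K)), hy, swapAut_algebraMap, C_0, add_zero, map_mul,
      map_mul, Bivariate.swap_C_C, Bivariate.swap_X, map_mul, hC, yy]
  have hab' : algebraMap k K a ^ N = algebraMap k K b := by rw [← map_pow, hab]
  have hba' : algebraMap k K b ^ N = algebraMap k K a := by rw [← map_pow, hba]
  apply algHom_ext_frac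
  · simp only [pow_two, AlgEquiv.mul_apply, henon_xx, henon_yy, hx', hy', map_mul, map_sub,
      map_pow, AlgEquiv.commutes, mul_pow, hab', mul_sub]
  · simp only [pow_two, AlgEquiv.mul_apply, henon_xx, henon_yy, hx', hy', map_mul, map_sub,
      map_pow, AlgEquiv.commutes, mul_pow, hab', ← mul_sub, hba']

end Centralizer

section Loxodromic

variable {k : Type u} [Field k] {K : Type u} [Field K] [Algebra k[X][Y] K]
  [IsFractionRing k[X][Y] K] [Algebra k K] [IsScalarTower k k[X][Y] K] {N : ℕ}

theorem log_two_le : Real.log 2 ≤ Real.log 1638400 :=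
  Real.log_le_log (by norm_num) (by norm_num)

theorem log_two_pos : 0 < Real.log 2 := Real.log_pos (by norm_num)

theorem add_one_lt_of_log_le (hN : 1000 * Real.log 1638400 ≤ Real.log N) {b : ℕ}
    (h : Real.log b ≤ Real.log N / 2 + 100 * Real.log 1638400) : b + 1 < N := by
  by_contra! hb
  have h2 := log_two_le
  have h0 := log_two_pos
  have hN2 : 2 ≤ N := by
    by_contra! hlt
    have : Real.log N = 0 := by interval_cases N <;> simp
    linarith
  have h3 : (N : ℝ) ≤ 2 * b := by exact_mod_cast (by omega : N ≤ 2 * b)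
  have hb0 : (b : ℝ) ≠ 0 := by exact_mod_cast (by omega : b ≠ 0)
  have h4 := Real.log_le_log (by exact_mod_cast (by omega : 0 < N)) h3
  rw [Real.log_mul (by norm_num) hb0] at h4
  linarith

theorem two_le_of_log_le (hN : 1000 * Real.log 1638400 ≤ Real.log N) : 2 ≤ N := by
  have := add_one_lt_of_log_le hN (b := 1) (by
    have h2 := log_two_le
    have h0 := log_two_pos
    simp only [Nat.cast_one, Real.log_one]
    linarith)
  omega

theorem commute_of_sdeg_le (hN : 1000 * Real.log 1638400 ≤ Real.log N) (hk : (N : k) ≠ 0)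
    {f : K ≃ₐ[k] K} (h : ∀ j : ℤ, |j| ≤ 1 →
      Real.log (sdeg (henon k K N ^ (-j) * f * henon k K N ^ j)) ≤
        Real.log N / 2 + 100 * Real.log 1638400) : Commute (henon k K N ^ 2) f := by
  have key : ∀ j : ℤ, |j| ≤ 1 → sdeg (henon k K N ^ (-j) * f * henon k K N ^ j) + 1 < N :=
    fun j hj => add_one_lt_of_log_le hN (h j hj)
  have h0 := key 0 (by norm_num)
  have h1 := key 1 (by norm_num)
  have h2 := key (-1) (by norm_num)
  simp only [neg_zero, zpow_zero, one_mul, mul_one, zpow_neg, zpow_one, neg_neg] at h0 h1 h2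
  have aux : ∀ φ : K ≃ₐ[k] K, sdeg φ + 1 < N → bdeg φ + 1 < N ∧ bdeg φ⁻¹ + 1 < N := by
    intro φ hφ
    simp only [sdeg] at hφ
    omega
  have h0' := aux _ h0
  have h1' := aux _ h1
  have h2' := aux _ h2
  simp only [mul_inv_rev, inv_inv, ← mul_assoc] at h1' h2'
  exact IsSmall.commute ⟨h0'.1, h1'.1, h2'.1⟩ ⟨h0'.2, h1'.2, h2'.2⟩ hk

theorem sdeg_mul_swap (φ : K ≃ₐ[k] K) : sdeg (φ * swapAut k K) = sdeg φ := by
  rw [sdeg, sdeg, bdeg_mul_swap, mul_inv_rev, swapAut_inv, bdeg_swap_mul]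

theorem isLoxodromic_henon (hN : 1000 * Real.log 1638400 ≤ Real.log N) (hk : (N : k) ≠ 0) :
    IsLoxodromic sdeg (henon k K N) (Real.log 1638400) (Real.log N) where
  one_le := one_le_sdeg
  inv := sdeg_inv
  mul_le := sdeg_mul_le
  four_point := logDist_four_point
  abs_sub_le n := by
    have hN2 := two_le_of_log_le hN
    have h0 : (0 : ℝ) < N := by exact_mod_cast (by omega : 0 < N)
    have key : ∀ n : ℕ, |Real.log (sdeg (henon k K N ^ n)) - n * Real.log N| ≤
        Real.log 1638400 := by
      intro n
      have h1 : (N : ℝ) ^ n ≤ sdeg (henon k K N ^ n) := by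
        rw [sdeg_henon_pow]; exact_mod_cast le_bdeg_henon_pow hN2 n
      have h2 : (sdeg (henon k K N ^ n) : ℝ) ≤ 4 * (N : ℝ) ^ n := by
        rw [sdeg_henon_pow]; exact_mod_cast bdeg_henon_pow_le hN2 n
      have h3 := Real.log_le_log (by positivity) h1
      have h4 := Real.log_le_log (lt_of_lt_of_le (by positivity) h1) h2
      rw [Real.log_mul (by norm_num) (by positivity)] at h4
      rw [Real.log_pow] at h3 h4
      have h5 : Real.log 4 ≤ Real.log 1638400 := Real.log_le_log (by norm_num) (by norm_num)
      rw [abs_le]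
      constructor <;> linarith [log_two_pos, log_two_le]
    rcases Int.eq_nat_or_neg n with ⟨m, rfl | rfl⟩
    · simpa using key m
    · rw [zpow_neg, sdeg_inv]
      simpa using key m
  pos := log_two_pos.trans_le log_two_le
  le := hN
  wpd u h := by
    left
    rw [mul_inv_eq_iff_eq_mul]
    exact (commute_of_sdeg_le hN hk h).symm
  wpd' u h := by
    right
    have h1 := commute_of_sdeg_le hN hk (f := u * swapAut k K) (fun j hj => by
      rw [← sdeg_mul_swap]
      have := swapAut_conj_henon_zpow (k := k) (K := K) N j
      rw [show henon k K N ^ (-j) * (u * swapAut k K) * henon k K N ^ j * swapAut k K =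
        henon k K N ^ (-j) * u * (swapAut k K * henon k K N ^ j * swapAut k K) by group, this]
      exact h j hj)
    have h2 := swapAut_conj_henon_zpow (k := k) (K := K) N 2
    rw [zpow_neg] at h2
    have h3 : swapAut k K * (henon k K N ^ 2)⁻¹ = henon k K N ^ 2 * swapAut k K := by
      rw [show (henon k K N ^ 2)⁻¹ = (henon k K N ^ (2 : ℤ))⁻¹ from rfl, ← h2, ← mul_assoc,
        ← mul_assoc, swapAut_mul_self, one_mul]
      rfl
    rw [mul_inv_eq_iff_eq_mul]
    have h4 : henon k K N ^ 2 * (u * swapAut k K) = u * swapAut k K * henon k K N ^ 2 := h1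
    have h5 : (henon k K N ^ 2)⁻¹ * (u * swapAut k K) = u * swapAut k K * (henon k K N ^ 2)⁻¹ :=
      h1.inv_left
    rw [mul_assoc, h3, ← mul_assoc, ← mul_assoc] at h5
    exact (mul_right_cancel h5).symm

variable (k K) in
theorem exists_normal_subgroup_algEquiv :
    ∃ H : Subgroup (K ≃ₐ[k] K), H.Normal ∧ H ≠ ⊥ ∧ H ≠ ⊤ := by
  obtain ⟨N, hN, hk⟩ : ∃ N : ℕ, 1638400 ^ 1000 ≤ N ∧ (N : k) ≠ 0 := by
    generalize 1638400 ^ 1000 = M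
    by_cases h : (M : k) = 0
    · exact ⟨M + 1, by omega, by simp [h]⟩
    · exact ⟨M, le_rfl, h⟩
  have hlog : 1000 * Real.log 1638400 ≤ Real.log N := by
    have h1 : (1638400 : ℝ) ^ 1000 ≤ N := by exact_mod_cast hN
    have h2 := Real.log_le_log (by positivity) h1
    rw [Real.log_pow] at h2
    exact_mod_cast h2
  have hlox := isLoxodromic_henon (K := K) hlog hk
  have hN2 := two_le_of_log_le hlog
  have hlt : Real.log 2 < Real.log N := by linarith [log_two_pos, log_two_le]
  have hone : bdeg (1 : K ≃ₐ[k] K) = 2 := bdeg_one k K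
  refine ⟨Subgroup.normalClosure {(henon k K N ^ 2) ^ 5100}, inferInstance, ?_, ?_⟩
  · intro h
    have h1 : (henon k K N ^ 2) ^ 5100 = 1 := by
      rw [← Subgroup.mem_bot, ← h]
      exact Subgroup.subset_normalClosure rfl
    have h2 := le_bdeg_henon_pow (k := k) (K := K) hN2 (2 * 5100)
    rw [← pow_mul] at h1
    rw [h1, hone] at h2
    have h3 : ∀ m, 2 ≤ m → 2 < N ^ m := fun m hm =>
      lt_of_lt_of_le (by norm_num) ((Nat.pow_le_pow_left hN2 2).trans
        (Nat.pow_le_pow_right (by omega) hm) : 2 ^ 2 ≤ N ^ m)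
    exact absurd h2 (h3 _ (by norm_num)).not_ge
  · intro h
    have h1 : swapAut k K ≠ 1 := by
      intro h1
      have h2 : height k (swapAut k K (xx k K)) = 1 := by rw [swapAut_xx, height_yy]
      rw [h1, AlgEquiv.one_apply, height_xx] at h2
      omega
    have h2 := hlox.lt_log_of_mem_normalClosure (swapAut k K) (h ▸ Subgroup.mem_top _) h1
    have h3 : bdeg (swapAut k K) = 2 := by rw [← mul_one (swapAut k K), bdeg_swap_mul, hone]
    rw [sdeg, swapAut_inv, max_self, h3] at h2
    push_cast at h2
    linarith

end Loxodromic

theorem exists_normal_of_mulEquiv {G G' : Type*} [Group G] [Group G'] (e : G ≃* G')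
    (h : ∃ H : Subgroup G, H.Normal ∧ H ≠ ⊥ ∧ H ≠ ⊤) :
    ∃ H : Subgroup G', H.Normal ∧ H ≠ ⊥ ∧ H ≠ ⊤ := by
  obtain ⟨H, hn, hb, ht⟩ := h
  refine ⟨H.map e.toMonoidHom, hn.map _ e.surjective, ?_, ?_⟩
  · rwa [Ne, Subgroup.map_eq_bot_iff_of_injective _ e.injective]
  · intro h
    apply ht
    rw [← Subgroup.comap_map_eq_self_of_injective (f := e.toMonoidHom) e.injective H, h,
      Subgroup.comap_top]

end Bivariate

/-- **Theorem of Lonjou.** For every field `k`, the plane Cremona group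
`Bir(ℙ²_k) = Aut_k(k(x,y))` is not simple: it possesses a normal subgroup different from
the trivial subgroup and from the whole group. -/
theorem lonjou_not_simple (k : Type u) [Field k] :
    ∃ N : Subgroup (CremonaK k), N.Normal ∧ N ≠ ⊥ ∧ N ≠ ⊤ := by
  exact exists_normal_of_mulEquiv
    (AlgEquiv.autCongr (IsFractionRing.algEquivOfAlgEquiv
      (Polynomial.Bivariate.equivMvPolynomial k)))
    (exists_normal_subgroup_algEquiv k (FractionRing (Polynomial (Polynomial k))))
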